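/- arXiv:1512.02279 — 2 statements merged into one kernel-verified Lean document; each statement's English description precedes it below -/
import Mathlib

section
/- For n ≥ 2, the partial Brauer monoid PB_n is not idempotent-generated. Moreover rank(PB_n) = n+1 if n ≤ 2, and rank(PB_n) = 4 if n ≥ 3. -/
/-!
Partial Brauer diagrams on `n` points are formalized as set partitions
(equivalence relations, i.e. `Setoid`s) of the vertex set
`{1,…,n} ∪ {1',…,n'}`, encoded as `Fin n ⊕ Fin n`
(`Sum.inl i` is the upper vertex `i`, `Sum.inr i` is the lower vertex `i'`),
all of whose blocks have size at most 2.  The product of two diagrams is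
defined via connectivity (paths) in the product graph, and the involution `*`
by interchanging the two rows of vertices.
-/

noncomputable section

open scoped Classical

/-- Vertices of a diagram on `n` points. -/
abbrev PBV (n : ℕ) := Fin n ⊕ Fin n

/-- A "diagram candidate": an arbitrary set partition of the vertices. -/
abbrev Dgm (n : ℕ) := Setoid (PBV n)

/-- The equivalence relation ("joined by a path") generated by a relation. -/
inductive RGen {V : Type*} (r : V → V → Prop) : V → V → Prop
  | rel {x y : V} : r x y → RGen r x y
  | refl (x : V) : RGen r x x
  | symm {x y : V} : RGen r x y → RGen r y x
  | trans {x y z : V} : RGen r x y → RGen r y z → RGen r x z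

namespace Dgm

variable {n : ℕ}

/-- Vertices of the product graph: top, middle and bottom rows. -/
abbrev V3 (n : ℕ) := Fin n ⊕ (Fin n ⊕ Fin n)

/-- The first factor occupies the top and middle rows of the product graph. -/
def topMid : PBV n → V3 n
  | Sum.inl i => Sum.inl i
  | Sum.inr i => Sum.inr (Sum.inl i)

/-- The second factor occupies the middle and bottom rows of the product graph. -/
def midBot : PBV n → V3 n
  | Sum.inl i => Sum.inr (Sum.inl i)
  | Sum.inr i => Sum.inr (Sum.inr i)

/-- The product diagram occupies the top and bottom rows of the product graph. -/
def topBot : PBV n → V3 n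
  | Sum.inl i => Sum.inl i
  | Sum.inr i => Sum.inr (Sum.inr i)

/-- The edges of the product graph `Γ(α, β)`. -/
def prodEdges (α β : Dgm n) (x y : V3 n) : Prop :=
  (∃ a b : PBV n, α.r a b ∧ x = topMid a ∧ y = topMid b) ∨
  (∃ a b : PBV n, β.r a b ∧ x = midBot a ∧ y = midBot b)

/-- The product of two diagrams: two vertices lie in the same block of `α β`
iff they are joined by a path in the product graph `Γ(α, β)`. -/
def pmul (α β : Dgm n) : Dgm n where
  r x y := RGen (prodEdges α β) (topBot x) (topBot y)
  iseqv := ⟨fun _ => RGen.refl _, fun h => h.symm, fun h₁ h₂ => h₁.trans h₂⟩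

/-- Interchanging the upper and the lower vertices. -/
def swapUD : PBV n → PBV n
  | Sum.inl i => Sum.inr i
  | Sum.inr i => Sum.inl i

/-- The involution `α ↦ α*` (reflection in a horizontal axis). -/
def pstar (α : Dgm n) : Dgm n := Setoid.comap swapUD α

/-- All blocks of `α` have size at most 2. -/
def IsPB (α : Dgm n) : Prop :=
  ∀ x y z : PBV n, α.r x y → α.r x z → x = y ∨ x = z ∨ y = z

/-- The partial Brauer monoid `PB_n` (as a set of diagrams). -/
def PBset (n : ℕ) : Set (Dgm n) := {α | IsPB α}

/-- The position of a vertex in the linear order `1 < 2 < ⋯ < n < n' < ⋯ < 1'`. -/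
def vpos : PBV n → ℕ
  | Sum.inl i => (i : ℕ)
  | Sum.inr i => 2 * n - 1 - (i : ℕ)

/-- Planarity: no two blocks cross in the order `1 < ⋯ < n < n' < ⋯ < 1'`. -/
def IsPlanar (α : Dgm n) : Prop :=
  ∀ a b c d : PBV n, α.r a b → α.r c d →
    vpos a < vpos c → vpos c < vpos b → vpos b < vpos d → False

/-- The Motzkin monoid `M_n` (as a set of diagrams). -/
def Mset (n : ℕ) : Set (Dgm n) := {α | IsPB α ∧ IsPlanar α}

/-- The domain of `α`: upper points lying in a transversal block. -/
def domSet (α : Dgm n) : Set (Fin n) := {i | ∃ j, α.r (Sum.inl i) (Sum.inr j)}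

/-- The codomain of `α`: lower points lying in a transversal block. -/
def codomSet (α : Dgm n) : Set (Fin n) := {i | ∃ j, α.r (Sum.inr i) (Sum.inl j)}

/-- The rank of a diagram: the number of its transversal blocks (for a diagram
with blocks of size at most 2, each transversal block contains exactly one
upper point, so this is the size of the domain). -/
def prank (α : Dgm n) : ℕ := (domSet α).ncard

/-- `α` is an idempotent. -/
def IsIdpt (α : Dgm n) : Prop := pmul α α = α

/-- `α` is a projection. -/
def IsProj (α : Dgm n) : Prop := pmul α α = α ∧ pstar α = α

/-- The D-class `D_r(PB_n)`. -/
def DPB (n r : ℕ) : Set (Dgm n) := {α | α ∈ PBset n ∧ prank α = r}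

/-- The ideal `I_r(PB_n)`. -/
def IPB (n r : ℕ) : Set (Dgm n) := {α | α ∈ PBset n ∧ prank α ≤ r}

/-- The D-class `D_r(M_n)`. -/
def DM (n r : ℕ) : Set (Dgm n) := {α | α ∈ Mset n ∧ prank α = r}

/-- The ideal `I_r(M_n)`. -/
def IM (n r : ℕ) : Set (Dgm n) := {α | α ∈ Mset n ∧ prank α ≤ r}

end Dgm

/-- Membership in the closure of a subset under a binary operation. -/
inductive MClo {γ : Type*} (m : γ → γ → γ) (X : Set γ) : γ → Prop
  | base {x : γ} : x ∈ X → MClo m X x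
  | mul {x y : γ} : MClo m X x → MClo m X y → MClo m X (m x y)

/-- The subsemigroup `⟨X⟩` generated by the subset `X`. -/
def genSet {γ : Type*} (m : γ → γ → γ) (X : Set γ) : Set γ := {x | MClo m X x}

/-- The rank of `T`: the least size of a generating set. -/
noncomputable def rnk {γ : Type*} (m : γ → γ → γ) (T : Set γ) : ℕ :=
  sInf {k | ∃ X : Finset γ, X.card = k ∧ genSet m ↑X = T}

/-- The idempotent rank of `T`: the least size of a generating set consisting
of idempotents. -/
noncomputable def idrnk {γ : Type*} (m : γ → γ → γ) (T : Set γ) : ℕ :=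
  sInf {k | ∃ X : Finset γ, X.card = k ∧ (∀ x ∈ X, m x x = x) ∧ genSet m ↑X = T}

/-- `T` is idempotent-generated. -/
def IdptGen {γ : Type*} (m : γ → γ → γ) (T : Set γ) : Prop :=
  genSet m {x ∈ T | m x x = x} = T

open Dgm
/-- `a(m)`: `a(0) = a(1) = 1` and `a(m) = a(m-1) + (m-1)·a(m-2)`. -/
def aSeq : ℕ → ℕ
  | 0 => 1
  | 1 => 1
  | (m + 2) => aSeq (m + 1) + (m + 1) * aSeq m

/-- The double factorial `k!!`, with the convention `k!! = 0` for even `k ≥ 0`. -/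
def oddDF : ℕ → ℕ
  | 0 => 0
  | 1 => 1
  | (k + 2) => (k + 2) * oddDF k

namespace Dgm

variable {n : ℕ}

/-- `{x}` is a singleton upper block of `α`. -/
def UpperSingleton (α : Dgm n) (x : Fin n) : Prop :=
  ∀ y : PBV n, α.r (Sum.inl x) y → y = Sum.inl x

/-- `{x'}` is a singleton lower block of `α`. -/
def LowerSingleton (α : Dgm n) (x : Fin n) : Prop :=
  ∀ y : PBV n, α.r (Sum.inr x) y → y = Sum.inr x

/-- The upper point `x` is nested: some upper block `{u,v}` has `u < x < v`. -/
def UpperNested (α : Dgm n) (x : Fin n) : Prop :=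
  ∃ u v : Fin n, α.r (Sum.inl u) (Sum.inl v) ∧ u < x ∧ x < v

/-- The lower point `x'` is nested: some lower block `{u',v'}` has `u < x < v`. -/
def LowerNested (α : Dgm n) (x : Fin n) : Prop :=
  ∃ u v : Fin n, α.r (Sum.inr u) (Sum.inr v) ∧ u < x ∧ x < v

/-- `α` has no unnested singleton (upper or lower) block. -/
def NoUnnestedSingleton (α : Dgm n) : Prop :=
  (∀ x, UpperSingleton α x → UpperNested α x) ∧
  (∀ x, LowerSingleton α x → LowerNested α x)

/-- A chain of `d` nested upper hooks of `α` around the upper point `x`: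
`u_{d-1} < ⋯ < u_0 < x < v_0 < ⋯ < v_{d-1}` with each `{u_i, v_i}` a block.
The singleton upper block `{x}` has nesting depth at most `k` iff there is no
such chain of length `k + 1`. -/
def UpperHookChain (α : Dgm n) (x : Fin n) (d : ℕ) : Prop :=
  ∃ u v : Fin d → Fin n,
    (∀ i, α.r (Sum.inl (u i)) (Sum.inl (v i))) ∧
    (∀ i, u i < x ∧ x < v i) ∧ StrictAnti u ∧ StrictMono v

/-- A chain of `d` nested lower hooks of `α` around the lower point `x'`. -/
def LowerHookChain (α : Dgm n) (x : Fin n) (d : ℕ) : Prop :=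
  ∃ u v : Fin d → Fin n,
    (∀ i, α.r (Sum.inr (u i)) (Sum.inr (v i))) ∧
    (∀ i, u i < x ∧ x < v i) ∧ StrictAnti u ∧ StrictMono v

/-- `λ_A`: the planar diagram joining the `k`-th smallest element of `A`
(upper) to `k` (lower), all other blocks being singletons. -/
def lamd (A : Finset (Fin n)) : Dgm n :=
  Setoid.ker (fun x : PBV n =>
    match x with
    | Sum.inl a =>
        if ha : a ∈ A then
          (Sum.inr (((A.orderIsoOfFin rfl).symm ⟨a, ha⟩ : Fin A.card) : ℕ) : ℕ ⊕ ℕ)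
        else Sum.inl (a : ℕ)
    | Sum.inr j => Sum.inr (j : ℕ))

/-- `ρ_A = (λ_A)*`. -/
def rhod (A : Finset (Fin n)) : Dgm n := pstar (lamd A)

/-- The diagram whose 2-element blocks are exactly `{i, (π i)'}` for `i < r`. -/
def permDgm (n r : ℕ) (π : Equiv.Perm (Fin r)) : Dgm n :=
  Setoid.ker (fun x : PBV n =>
    match x with
    | Sum.inl a =>
        if h : (a : ℕ) < r then (Sum.inr ((π ⟨(a : ℕ), h⟩ : Fin r) : ℕ) : ℕ ⊕ ℕ)
        else Sum.inl (a : ℕ)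
    | Sum.inr j => Sum.inr (j : ℕ))

/-- The set `S_{[r]} ⊆ PB_n`. -/
def SBr (n r : ℕ) : Set (Dgm n) := {γ | ∃ π : Equiv.Perm (Fin r), γ = permDgm n r π}

/-- The domain of `α` as a `Finset`. -/
def domFinset (α : Dgm n) : Finset (Fin n) :=
  Finset.univ.filter fun i => i ∈ domSet α

/-- The codomain of `α` as a `Finset`. -/
def codomFinset (α : Dgm n) : Finset (Fin n) :=
  Finset.univ.filter fun i => i ∈ codomSet α

/-- `A ⊆ {1,…,n}` is cosparse: its complement contains no two consecutive
elements. -/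
def CosparseS (A : Set (Fin n)) : Prop :=
  ∀ i j : Fin n, i ∉ A → j ∉ A → (j : ℕ) ≠ (i : ℕ) + 1

/-- `id_A`: the diagram with blocks `{a, a'}` for `a ∈ A`, all other blocks
being singletons. -/
def idd (A : Set (Fin n)) : Dgm n :=
  Setoid.ker (fun x : PBV n =>
    match x with
    | Sum.inl a => if a ∈ A then (Sum.inr (a : ℕ) : ℕ ⊕ ℕ) else Sum.inl (a : ℕ)
    | Sum.inr j => Sum.inr (j : ℕ))

end Dgm

namespace PBproof

variable {n : ℕ}

/-- The relation on two-colourings compatible with a diagram. -/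
def Rc (α : Dgm n) (f g : Fin n → Prop) : Prop :=
  ∀ x y, α.r x y → (Sum.elim f g x ↔ Sum.elim f g y)

theorem RGen_col {V T : Type*} {r : V → V → Prop} (c : V → T)
    (h : ∀ x y, r x y → c x = c y) {x y : V} (hxy : RGen r x y) : c x = c y := by
  induction hxy with
  | rel hr => exact h _ _ hr
  | refl => rfl
  | symm _ ih => exact ih.symm
  | trans _ _ ih1 ih2 => exact ih1.trans ih2

theorem Rc_mul {α β : Dgm n} {f h : Fin n → Prop} :
    Rc (pmul α β) f h ↔ ∃ g, Rc α f g ∧ Rc β g h := by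
  constructor
  · intro hR
    let C : V3 n → Prop := fun v => ∃ z, Sum.elim f h z ∧ RGen (prodEdges α β) (topBot z) v
    have hC : ∀ z, C (topBot z) ↔ Sum.elim f h z := by
      intro z
      constructor
      · rintro ⟨w, hw, hp⟩
        exact (hR w z hp).1 hw
      · intro hz
        exact ⟨z, hz, RGen.refl _⟩
    have hE : ∀ u v, prodEdges α β u v → (C u ↔ C v) := by
      intro u v e
      constructor
      · rintro ⟨w, hw, hp⟩
        exact ⟨w, hw, hp.trans (RGen.rel e)⟩
      · rintro ⟨w, hw, hp⟩
        exact ⟨w, hw, hp.trans (RGen.rel e).symm⟩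
    refine ⟨fun m => C (Sum.inr (Sum.inl m)), ?_, ?_⟩
    · intro a b hab
      have h1 : ∀ a, Sum.elim f (fun m => C (Sum.inr (Sum.inl m))) a ↔ C (topMid a) := by
        rintro (a | a)
        · exact (hC (Sum.inl a)).symm
        · exact Iff.rfl
      rw [h1, h1]
      exact hE _ _ (Or.inl ⟨a, b, hab, rfl, rfl⟩)
    · intro a b hab
      have h1 : ∀ a, Sum.elim (fun m => C (Sum.inr (Sum.inl m))) h a ↔ C (midBot a) := by
        rintro (a | a)
        · exact Iff.rfl
        · exact (hC (Sum.inr a)).symm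
      rw [h1, h1]
      exact hE _ _ (Or.inr ⟨a, b, hab, rfl, rfl⟩)
  · rintro ⟨g, h1, h2⟩ x y hxy
    have := RGen_col (Sum.elim f (Sum.elim g h)) (x := topBot x) (y := topBot y) ?_ hxy
    · have e : ∀ z, Sum.elim f (Sum.elim g h) (topBot z) = Sum.elim f h z := by
        rintro (z | z) <;> rfl
      rw [e, e] at this
      exact this ▸ Iff.rfl
    · rintro u v (⟨a, b, hab, rfl, rfl⟩ | ⟨a, b, hab, rfl, rfl⟩)
      · have e : ∀ z, Sum.elim f (Sum.elim g h) (topMid z) = Sum.elim f g z := by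
          rintro (z | z) <;> rfl
        rw [e, e]
        exact propext (h1 _ _ hab)
      · have e : ∀ z, Sum.elim f (Sum.elim g h) (midBot z) = Sum.elim g h z := by
          rintro (z | z) <;> rfl
        rw [e, e]
        exact propext (h2 _ _ hab)

theorem rel_iff (α : Dgm n) (x y : PBV n) :
    α.r x y ↔ ∀ f g, Rc α f g → (Sum.elim f g x ↔ Sum.elim f g y) := by
  constructor
  · intro h f g hR
    exact hR x y h
  · intro h
    have e : ∀ z, Sum.elim (fun m => α.r x (Sum.inl m)) (fun m => α.r x (Sum.inr m)) z ↔ α.r x z := by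
      rintro (z | z) <;> rfl
    have := h (fun m => α.r x (Sum.inl m)) (fun m => α.r x (Sum.inr m)) ?_
    · rw [e, e] at this
      exact this.1 (α.iseqv.refl x)
    · intro a b hab
      rw [e, e]
      exact ⟨fun h => α.iseqv.trans h hab, fun h => α.iseqv.trans h (α.iseqv.symm hab)⟩

theorem Rc_inj {α β : Dgm n} (h : ∀ f g, Rc α f g ↔ Rc β f g) : α = β := by
  ext x y
  rw [rel_iff, rel_iff]
  simp only [h]

theorem pmul_assoc (α β γ : Dgm n) : pmul (pmul α β) γ = pmul α (pmul β γ) := by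
  apply Rc_inj
  intro f g
  simp only [Rc_mul]
  constructor
  · rintro ⟨a, ⟨b, h1, h2⟩, h3⟩
    exact ⟨b, h1, a, h2, h3⟩
  · rintro ⟨b, h1, a, h2, h3⟩
    exact ⟨a, ⟨b, h1, h2⟩, h3⟩

/-- The diagram of a permutation. -/
def permD (π : Equiv.Perm (Fin n)) : Dgm n := Setoid.ker (Sum.elim π id)

/-- The projection with singletons at `i`. -/
def eps (i : Fin n) : Dgm n :=
  Setoid.ker (Sum.elim (fun m => (m, decide (m = i))) (fun m => (m, false)) : PBV n → Fin n × Bool)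

/-- The hook projection. -/
def tau (i j : Fin n) : Dgm n :=
  Setoid.ker (Sum.elim (fun m => if m = i ∨ m = j then (i, true) else (m, false))
    (fun m => if m = j then (i, false) else (m, false)) : PBV n → Fin n × Bool)

theorem Rc_perm {π : Equiv.Perm (Fin n)} {f g : Fin n → Prop} :
    Rc (permD π) f g ↔ ∀ a, f a ↔ g (π a) := by
  constructor
  · intro h a
    exact h (Sum.inl a) (Sum.inr (π a)) rfl
  · rintro h (a | a) (b | b) hab
    · have : π a = π b := hab
      rw [π.injective this]
    · have : π a = b := hab
      subst this; exact h a
    · have : a = π b := hab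
      subst this; exact (h b).symm
    · have : a = b := hab
      rw [this]

theorem Rc_eps {i : Fin n} {f g : Fin n → Prop} :
    Rc (eps i) f g ↔ ∀ a, a ≠ i → (f a ↔ g a) := by
  constructor
  · intro h a ha
    exact h (Sum.inl a) (Sum.inr a) (by change (_, _) = (_, _); simp [ha])
  · rintro h (a | a) (b | b) hab
    · have : (a, decide (a = i)) = (b, decide (b = i)) := hab
      simp at this; simp [this.1]
    · have : (a, decide (a = i)) = (b, false) := hab
      simp at this; obtain ⟨rfl, h2⟩ := this; exact h a h2
    · have : (a, false) = (b, decide (b = i)) := hab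
      simp at this; obtain ⟨rfl, h2⟩ := this; exact (h a h2).symm
    · have : (a, false) = (b, false) := hab
      simp at this; simp [this]

theorem Rc_tau {i j : Fin n} (hij : i ≠ j) {f g : Fin n → Prop} :
    Rc (tau i j) f g ↔ (f i ↔ f j) ∧ (g i ↔ g j) ∧ ∀ a, a ≠ i → a ≠ j → (f a ↔ g a) := by
  constructor
  · intro h
    refine ⟨h (Sum.inl i) (Sum.inl j) ?_, h (Sum.inr i) (Sum.inr j) ?_,
      fun a h1 h2 => h (Sum.inl a) (Sum.inr a) ?_⟩
    · change (if _ then _ else _) = (if _ then _ else _); simp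
    · change (if _ then _ else _) = (if _ then _ else _); simp
    · change (if _ then _ else _) = (if _ then _ else _); simp [h1, h2]
  · rintro ⟨h1, h2, h3⟩ (a | a) (b | b) hab <;>
      change (if _ then _ else _) = (if _ then _ else _) at hab <;>
      simp only [Sum.elim_inl, Sum.elim_inr] <;> split_ifs at hab <;> grind

instance : Mul (Dgm n) := ⟨pmul⟩
instance : One (Dgm n) := ⟨permD 1⟩

theorem mul_def (a b : Dgm n) : a * b = pmul a b := rfl

theorem Rc_mul' {α β : Dgm n} {f h : Fin n → Prop} :
    Rc (α * β) f h ↔ ∃ g, Rc α f g ∧ Rc β g h := Rc_mul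

theorem Rc_one {f g : Fin n → Prop} : Rc (1 : Dgm n) f g ↔ f = g := by
  change Rc (permD 1) f g ↔ _
  rw [Rc_perm]
  simp [funext_iff]

instance : Monoid (Dgm n) where
  mul_assoc := pmul_assoc
  one_mul a := by
    apply Rc_inj; intro f g; rw [Rc_mul']; simp [Rc_one]
  mul_one a := by
    apply Rc_inj; intro f g; rw [Rc_mul']; simp [Rc_one]

instance : Finite (Dgm n) :=
  Finite.of_injective (fun α : Dgm n => α.r) (fun a b h => by
    ext x y; exact iff_of_eq (congrFun (congrFun h x) y))

theorem isUnit_left {a b : Dgm n} (h : IsUnit (a * b)) : IsUnit a := isUnit_of_mul_isUnit_left h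
theorem isUnit_right {a b : Dgm n} (h : IsUnit (a * b)) : IsUnit b := isUnit_of_mul_isUnit_right h

theorem permD_mul (π ρ : Equiv.Perm (Fin n)) : permD π * permD ρ = permD (ρ * π) := by
  apply Rc_inj; intro f g
  simp only [Rc_mul', Rc_perm]
  constructor
  · rintro ⟨k, h1, h2⟩ a
    rw [h1, h2]; rfl
  · intro h
    exact ⟨fun a => g (ρ a), fun a => h a, fun a => Iff.rfl⟩

theorem permD_one : permD (1 : Equiv.Perm (Fin n)) = 1 := rfl

theorem permD_pow (π : Equiv.Perm (Fin n)) (k : ℕ) : permD π ^ k = permD (π ^ k) := by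
  induction k with
  | zero => simp [permD_one]
  | succ k ih => rw [pow_succ, ih, permD_mul, pow_succ']

theorem permD_inj : Function.Injective (permD (n := n)) := by
  intro π ρ h
  ext a
  have : (permD ρ).r (Sum.inl a) (Sum.inr (π a)) := by rw [← h]; rfl
  have : ρ a = π a := this
  rw [this]

theorem isUnit_permD (π : Equiv.Perm (Fin n)) : IsUnit (permD π) := by
  refine ⟨⟨permD π, permD π⁻¹, ?_, ?_⟩, rfl⟩ <;> rw [permD_mul] <;> simp [permD_one]

/-- Totality is the absence of upper hooks. -/
def Tot (α : Dgm n) : Prop := ∀ f, ∃ g, Rc α f g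

theorem Tot.mul {α β : Dgm n} (h1 : Tot α) (h2 : Tot β) : Tot (α * β) := by
  intro f
  obtain ⟨g, hg⟩ := h1 f
  obtain ⟨k, hk⟩ := h2 g
  exact ⟨k, Rc_mul'.2 ⟨g, hg, hk⟩⟩

theorem isUnit_tot {α : Dgm n} (h : IsUnit α) : Tot α := by
  obtain ⟨b, hb⟩ := h.exists_right_inv
  intro f
  have : Rc (α * b) f f := by rw [hb, Rc_one]
  obtain ⟨g, hg, -⟩ := Rc_mul'.1 this
  exact ⟨g, hg⟩

theorem not_tot {α : Dgm n} (h : ¬ Tot α) :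
    ∃ i j, i ≠ j ∧ α.r (Sum.inl i) (Sum.inl j) := by
  by_contra hc
  apply h
  have hc' : ∀ i j, α.r (Sum.inl i) (Sum.inl j) → i = j := by
    intro i j hr
    by_contra hne
    exact hc ⟨i, j, hne, hr⟩
  have S := @α.iseqv.symm
  have T := @α.iseqv.trans
  intro f
  refine ⟨fun k => ∃ i, α.r (Sum.inl i) (Sum.inr k) ∧ f i, ?_⟩
  have key : ∀ i k, α.r (Sum.inl i) (Sum.inr k) →
      (f i ↔ ∃ i, α.r (Sum.inl i) (Sum.inr k) ∧ f i) := by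
    intro i k hik
    constructor
    · intro hf; exact ⟨i, hik, hf⟩
    · rintro ⟨i', h1, h2⟩
      rwa [hc' i i' (T hik (S h1))]
  rintro (a | a) (b | b) hab
  · rw [hc' a b hab]
  · exact key a b hab
  · exact (key b a (S hab)).symm
  · constructor
    · rintro ⟨i, h1, h2⟩; exact ⟨i, T h1 hab, h2⟩
    · rintro ⟨i, h1, h2⟩; exact ⟨i, T h1 (S hab), h2⟩

theorem tau_not_tot {i j : Fin n} (hij : i ≠ j) : ¬ Tot (tau i j) := by
  intro h
  obtain ⟨g, hg⟩ := h (fun m => m = i)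
  have := ((Rc_tau hij).1 hg).1
  simp at this
  exact hij this.symm

theorem dom_mul {α β : Dgm n} {i : Fin n} (h : i ∈ domSet (α * β)) : i ∈ domSet α := by
  by_contra hi
  obtain ⟨k, hk⟩ := h
  have hR : Rc (α * β) (fun m => α.r (Sum.inl i) (Sum.inl m)) (fun _ => False) := by
    refine Rc_mul'.2 ⟨fun _ => False, ?_, ?_⟩
    · have e : ∀ z, Sum.elim (fun m => α.r (Sum.inl i) (Sum.inl m)) (fun _ => False) z
          ↔ α.r (Sum.inl i) z := by
        rintro (z | z)
        · rfl
        · constructor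
          · intro h; exact h.elim
          · intro h; exact hi ⟨z, h⟩
      intro a b hab
      rw [e, e]
      exact ⟨fun h => α.iseqv.trans h hab, fun h => α.iseqv.trans h (α.iseqv.symm hab)⟩
    · rintro (a | a) (b | b) _ <;> rfl
  exact (hR _ _ hk).1 (α.iseqv.refl _)

theorem dom_perm_mul {π : Equiv.Perm (Fin n)} {β : Dgm n} {i : Fin n}
    (h : i ∈ domSet (permD π * β)) : π i ∈ domSet β := by
  obtain ⟨k, hk⟩ := h
  refine ⟨k, (rel_iff _ _ _).2 fun f g hR => ?_⟩
  have := (rel_iff _ _ _).1 hk (fun a => f (π a)) g (Rc_mul'.2 ⟨f, Rc_perm.2 fun a => Iff.rfl, hR⟩)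
  exact this

theorem dom_unit {α : Dgm n} (h : IsUnit α) (i : Fin n) : i ∈ domSet α := by
  obtain ⟨b, hb⟩ := h.exists_right_inv
  apply dom_mul (β := b)
  rw [hb]
  exact ⟨i, rfl⟩

theorem eq_perm {α : Dgm n} (hα : IsPB α) (h : ∀ i, i ∈ domSet α) : ∃ π, α = permD π := by
  choose p hp using h
  have S := @α.iseqv.symm
  have T := @α.iseqv.trans
  have inj : Function.Injective p := by
    intro a b hab
    have h1 := hp a
    rw [hab] at h1
    have := hα (Sum.inl a) (Sum.inr (p b)) (Sum.inl b) h1 (T h1 (S (hp b)))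
    simpa using this
  have bij := Finite.injective_iff_bijective.1 inj
  refine ⟨Equiv.ofBijective p bij, ?_⟩
  have key : ∀ a z, α.r (Sum.inl a) z → z = Sum.inl a ∨ z = Sum.inr (p a) := by
    intro a z hz
    have := hα (Sum.inl a) (Sum.inr (p a)) z (hp a) hz
    simp at this
    tauto
  apply Rc_inj
  intro f g
  rw [Rc_perm]
  constructor
  · intro hR a
    exact hR _ _ (hp a)
  · intro hR
    have e : ∀ z, ∃ a, α.r (Sum.inl a) z ∧ (Sum.elim f g z ↔ f a) := by
      rintro (z | z)
      · exact ⟨z, α.iseqv.refl _, Iff.rfl⟩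
      · obtain ⟨a, rfl⟩ := bij.2 z
        exact ⟨a, hp a, (hR a).symm⟩
    intro x y hxy
    obtain ⟨a, h1, h2⟩ := e x
    obtain ⟨b, h3, h4⟩ := e y
    rw [h2, h4]
    have := key a (Sum.inl b) (T h1 (T hxy (S h3)))
    simp at this
    rw [this]

theorem pmul_label {T : Type*} {α β : Dgm n} (L : V3 n → T)
    (h1 : ∀ a b, α.r a b → L (topMid a) = L (topMid b))
    (h2 : ∀ a b, β.r a b → L (midBot a) = L (midBot b)) {x y : PBV n}
    (h : (α * β).r x y) : L (topBot x) = L (topBot y) := by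
  refine RGen_col L ?_ h
  rintro u v (⟨a, b, hab, rfl, rfl⟩ | ⟨a, b, hab, rfl, rfl⟩)
  · exact h1 a b hab
  · exact h2 a b hab

theorem isPB_one : IsPB (1 : Dgm n) := by
  rintro (x | x) (y | y) (z | z) h1 h2 <;>
    change (_ : Fin n) = _ at h1 <;> change (_ : Fin n) = _ at h2 <;> simp at h1 h2 ⊢ <;> grind

theorem isPB_perm_mul (π : Equiv.Perm (Fin n)) {β : Dgm n} (hβ : IsPB β) :
    IsPB (permD π * β) := by
  have key : ∀ x y, (permD π * β).r x y → β.r (Sum.map π id x) (Sum.map π id y) := by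
    intro x y h
    have := pmul_label (T := Quotient β)
      (Sum.elim (fun m => Quotient.mk β (Sum.inl (π m)))
        (Sum.elim (fun m => Quotient.mk β (Sum.inl m)) (fun m => Quotient.mk β (Sum.inr m))))
      ?_ ?_ h
    · apply Quotient.exact (s := β)
      rcases x with x | x <;> rcases y with y | y <;> exact this
    · have e : ∀ a, (Sum.elim (fun m => Quotient.mk β (Sum.inl (π m)))
        (Sum.elim (fun m => Quotient.mk β (Sum.inl m)) (fun m => Quotient.mk β (Sum.inr m))))
          (topMid a) = Quotient.mk β (Sum.inl (Sum.elim π id a)) := by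
        rintro (a | a) <;> rfl
      intro a b hab
      have hab' : Sum.elim π id a = Sum.elim π id b := hab
      rw [e, e, hab']
    · have e : ∀ a, (Sum.elim (fun m => Quotient.mk β (Sum.inl (π m)))
        (Sum.elim (fun m => Quotient.mk β (Sum.inl m)) (fun m => Quotient.mk β (Sum.inr m))))
          (midBot a) = Quotient.mk β a := by
        rintro (a | a) <;> rfl
      intro a b hab
      rw [e, e]
      exact Quotient.sound (s := β) hab
  intro x y z h1 h2
  have inj : Function.Injective (Sum.map π id : PBV n → PBV n) :=
    Sum.map_injective.2 ⟨π.injective, Function.injective_id⟩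
  have := hβ _ _ _ (key _ _ h1) (key _ _ h2)
  simpa only [inj.eq_iff] using this

theorem isPB_eps_mul (i : Fin n) {β : Dgm n} (hβ : IsPB β) : IsPB (eps i * β) := by
  let L : V3 n → Option (Quotient β) :=
    Sum.elim (fun m => if m = i then none else some (Quotient.mk β (Sum.inl m)))
        (Sum.elim (fun m => some (Quotient.mk β (Sum.inl m)))
          (fun m => some (Quotient.mk β (Sum.inr m))))
  have e : ∀ x, L (topBot x) = if x = Sum.inl i then none else some (Quotient.mk β x) := by
    rintro (x | x) <;> simp [L, topBot]
  have key : ∀ x y, (eps i * β).r x y → L (topBot x) = L (topBot y) := by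
    intro x y h
    refine pmul_label L ?_ ?_ h
    · rintro (a | a) (b | b) hab <;> change (_, _) = (_, _) at hab <;>
        simp only [Prod.mk.injEq] at hab <;> obtain ⟨rfl, hab⟩ := hab <;>
        simp_all [L, topMid]
    · have e : ∀ a, L (midBot a) = some (Quotient.mk β a) := by
        rintro (a | a) <;> rfl
      intro a b hab
      rw [e, e]
      exact congrArg some (Quotient.sound (s := β) hab)
  intro x y z h1 h2
  have k1 := key _ _ h1
  have k2 := key _ _ h2
  rw [e, e] at k1 k2
  by_cases hx : x = Sum.inl i
  · by_cases hy : y = Sum.inl i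
    · left; rw [hx, hy]
    · simp [hx, hy] at k1
  · by_cases hy : y = Sum.inl i
    · simp [hx, hy] at k1
    · by_cases hz : z = Sum.inl i
      · simp [hx, hz] at k2
      · simp only [hx, hy, hz, if_false, Option.some.injEq] at k1 k2
        exact hβ _ _ _ (Quotient.exact k1) (Quotient.exact k2)

theorem isPB_tau_mul (i j : Fin n) {β : Dgm n} (hβ : IsPB β) : IsPB (tau i j * β) := by
  have S := @β.iseqv.symm
  have T := @β.iseqv.trans
  let W : PBV n → Option (Quotient β) := fun v =>
    if β.r (Sum.inl i) v ∨ β.r (Sum.inl j) v then none else some (Quotient.mk β v)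
  have hW : ∀ a b, β.r a b → W a = W b := by
    intro a b hab
    have h1 : β.r (Sum.inl i) a ↔ β.r (Sum.inl i) b := ⟨fun h => T h hab, fun h => T h (S hab)⟩
    have h2 : β.r (Sum.inl j) a ↔ β.r (Sum.inl j) b := ⟨fun h => T h hab, fun h => T h (S hab)⟩
    have h3 : Quotient.mk β a = Quotient.mk β b := Quotient.sound (s := β) hab
    simp only [W, h1, h2, h3]
  have Wi : W (Sum.inl i) = none := if_pos (Or.inl (β.iseqv.refl _))
  have Wj : W (Sum.inl j) = none := if_pos (Or.inr (β.iseqv.refl _))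
  let L : V3 n → Option (Option (Quotient β)) :=
    Sum.elim (fun m => if m = i ∨ m = j then none else some (W (Sum.inl m)))
        (Sum.elim (fun m => some (W (Sum.inl m)))
          (fun m => some (W (Sum.inr m))))
  have e : ∀ x, L (topBot x) =
      if x = Sum.inl i ∨ x = Sum.inl j then none else some (W x) := by
    rintro (x | x) <;> simp [L, topBot]
  have key : ∀ x y, (tau i j * β).r x y → L (topBot x) = L (topBot y) := by
    intro x y h
    refine pmul_label L ?_ ?_ h
    · rintro (a | a) (b | b) hab <;>
        change (if _ then _ else _) = (if _ then _ else _) at hab <;>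
        simp only [L, topMid, Sum.elim_inl, Sum.elim_inr] <;> split_ifs at hab <;> grind
    · have e : ∀ a, L (midBot a) = some (W a) := by
        rintro (a | a) <;> rfl
      intro a b hab
      rw [e, e]
      exact congrArg some (hW _ _ hab)
  intro x y z h1 h2
  have k1 := key _ _ h1
  have k2 := key _ _ h2
  rw [e, e] at k1 k2
  by_cases hx : x = Sum.inl i ∨ x = Sum.inl j
  · by_cases hy : y = Sum.inl i ∨ y = Sum.inl j
    · by_cases hz : z = Sum.inl i ∨ z = Sum.inl j
      · grind
      · simp only [hx, hz, if_true, if_false] at k2; simp at k2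
    · simp only [hx, hy, if_true, if_false] at k1; simp at k1
  · by_cases hy : y = Sum.inl i ∨ y = Sum.inl j
    · simp only [hx, hy, if_true, if_false] at k1; simp at k1
    · by_cases hz : z = Sum.inl i ∨ z = Sum.inl j
      · simp only [hx, hz, if_true, if_false] at k2; simp at k2
      · simp only [hx, hy, hz, if_false, Option.some.injEq] at k1 k2
        have P := hβ
        by_cases wx : β.r (Sum.inl i) x ∨ β.r (Sum.inl j) x
        · by_cases wy : β.r (Sum.inl i) y ∨ β.r (Sum.inl j) y
          · by_cases wz : β.r (Sum.inl i) z ∨ β.r (Sum.inl j) z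
            · have pi := hβ (Sum.inl i)
              have pj := hβ (Sum.inl j)
              grind
            · simp only [W, wx, wz, if_true, if_false] at k2; simp at k2
          · simp only [W, wx, wy, if_true, if_false] at k1; simp at k1
        · by_cases wy : β.r (Sum.inl i) y ∨ β.r (Sum.inl j) y
          · simp only [W, wx, wy, if_true, if_false] at k1; simp at k1
          · by_cases wz : β.r (Sum.inl i) z ∨ β.r (Sum.inl j) z
            · simp only [W, wx, wz, if_true, if_false] at k2; simp at k2
            · simp only [W, wx, wy, wz, if_false, Option.some.injEq] at k1 k2
              exact hβ _ _ _ (Quotient.exact k1) (Quotient.exact k2)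

/-- Detach `a` and `b` from their blocks and join them. -/
def jn (α : Dgm n) (a b : PBV n) : Dgm n :=
  Setoid.ker (fun x => if x = a ∨ x = b then none else some (Quotient.mk α x))

theorem jn_r {α : Dgm n} {a b x y : PBV n} : (jn α a b).r x y ↔
    ((x = a ∨ x = b) ∧ (y = a ∨ y = b)) ∨
      (¬ (x = a ∨ x = b) ∧ ¬ (y = a ∨ y = b) ∧ α.r x y) := by
  have : (jn α a b).r x y ↔ (if x = a ∨ x = b then none else some (Quotient.mk α x)) =
      (if y = a ∨ y = b then none else some (Quotient.mk α y)) := Iff.rfl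
  rw [this]
  have q : Quotient.mk α x = Quotient.mk α y ↔ α.r x y := Quotient.eq (r := α)
  by_cases hx : x = a ∨ x = b <;> by_cases hy : y = a ∨ y = b <;>
    simp only [hx, hy, if_true, if_false] <;> simp [q]

theorem jn_PB {α : Dgm n} (h : IsPB α) (a b : PBV n) : IsPB (jn α a b) := by
  intro x y z h1 h2
  rw [jn_r] at h1 h2
  have := h x y z
  grind

theorem jn_dom {α : Dgm n} {i k : Fin n} (hi : i ∉ domSet α) (hk : k ∉ codomSet α) :
    domSet α ⊆ domSet (jn α (Sum.inl i) (Sum.inr k)) := by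
  rintro m ⟨l, hl⟩
  refine ⟨l, jn_r.2 (Or.inr ⟨?_, ?_, hl⟩)⟩
  · simp; rintro rfl; exact hi ⟨l, hl⟩
  · simp; rintro rfl; exact hk ⟨m, α.iseqv.symm hl⟩

theorem jn_dom_self {α : Dgm n} {i k : Fin n} : i ∈ domSet (jn α (Sum.inl i) (Sum.inr k)) :=
  ⟨k, jn_r.2 (by simp)⟩

theorem jn_dom_not {α : Dgm n} {i j k : Fin n} (hj : j ∉ domSet α) (hij : j ≠ i) :
    j ∉ domSet (jn α (Sum.inl i) (Sum.inr k)) := by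
  rintro ⟨l, hl⟩
  rw [jn_r] at hl
  rcases hl with hl | hl
  · simp at hl; exact hij hl.1
  · exact hj ⟨l, hl.2.2⟩

theorem jn_codom_not {α : Dgm n} {i k l : Fin n} (hl : l ∉ codomSet α) (hkl : l ≠ k) :
    l ∉ codomSet (jn α (Sum.inl i) (Sum.inr k)) := by
  rintro ⟨m, hm⟩
  rw [jn_r] at hm
  rcases hm with hm | hm
  · simp at hm; exact hkl hm.1
  · exact hl ⟨m, hm.2.2⟩

theorem step2 {α P : Dgm n} {i j k l : Fin n} (hijkl : i = j ↔ k = l)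
    (hi : ∀ z, α.r (Sum.inl i) z → z = Sum.inl i ∨ z = Sum.inl j)
    (hj : ∀ z, α.r (Sum.inl j) z → z = Sum.inl i ∨ z = Sum.inl j)
    (hk : ∀ z, α.r (Sum.inr k) z → z = Sum.inr k ∨ z = Sum.inr l)
    (hl : ∀ z, α.r (Sum.inr l) z → z = Sum.inr k ∨ z = Sum.inr l)
    (hP : ∀ f g, Rc P f g ↔ (α.r (Sum.inl i) (Sum.inl j) → (f i ↔ f j)) ∧
      (α.r (Sum.inr k) (Sum.inr l) → (g i ↔ g j)) ∧ ∀ a, a ≠ i → a ≠ j → (f a ↔ g a)) :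
    α = P * jn (jn α (Sum.inl i) (Sum.inr k)) (Sum.inl j) (Sum.inr l) := by
  have S := @α.iseqv.symm
  have agree : ∀ f g h : Fin n → Prop, (∀ a, a ≠ i → a ≠ j → (f a ↔ g a)) →
      ∀ x : PBV n, x ≠ Sum.inl i → x ≠ Sum.inl j → (Sum.elim f h x ↔ Sum.elim g h x) := by
    rintro f g h hfg (x | x) h1 h2
    · exact hfg x (by simpa using h1) (by simpa using h2)
    · rfl
  apply Rc_inj
  intro f h
  simp only [Rc_mul', hP]
  constructor
  · intro hR
    refine ⟨fun a => if a = i then h k else if a = j then h l else f a, ⟨?_, ?_, ?_⟩, ?_⟩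
    · intro hh; exact hR _ _ hh
    · intro hh
      have := hR _ _ hh
      simp only [Sum.elim_inr] at this
      by_cases hij : j = i
      · simp [hij]
      · simpa [hij] using this
    · intro a h1 h2
      simp [h1, h2]
    · set g : Fin n → Prop := fun a => if a = i then h k else if a = j then h l else f a with hg
      have gi : g i ↔ h k := by simp [hg]
      have gj : g j ↔ h l := by
        by_cases hij : j = i
        · have := hijkl.1 hij.symm
          simp [hg, hij, this]
        · simp [hg, hij]
      have ag := agree f g h (by intro a h1 h2; simp [hg, h1, h2])
      intro x y hxy
      simp only [jn_r] at hxy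
      rcases hxy with ⟨hx, hy⟩ | ⟨hx, hy, ⟨hx', hy'⟩ | ⟨hx', hy', hxy⟩⟩
      · rcases hx with rfl | rfl <;> rcases hy with rfl | rfl <;> simp [gj]
      · rcases hx' with rfl | rfl <;> rcases hy' with rfl | rfl <;> simp [gi]
      · push Not at hx hy hx' hy'
        rw [← ag x hx'.1 hx.1, ← ag y hy'.1 hy.1]
        exact hR _ _ hxy
  · rintro ⟨g, ⟨h1, h2, h3⟩, h4⟩ x y hxy
    have gi : g i ↔ h k := by
      refine h4 (Sum.inl i) (Sum.inr k) ?_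
      simp only [jn_r]
      by_cases hij : i = j
      · left; simp [hij, hijkl.1 hij]
      · right
        have : k ≠ l := fun h => hij (hijkl.2 h)
        simp [hij, this]
    have gj : g j ↔ h l := h4 (Sum.inl j) (Sum.inr l) (by simp [jn_r])
    have ag := agree f g h h3
    have cases1 : ∀ a b, a = i ∨ a = j → b = i ∨ b = j → α.r (Sum.inl a) (Sum.inl b) →
        (f a ↔ f b) := by
      rintro a b (rfl | rfl) (rfl | rfl) hab
      · rfl
      · exact h1 hab
      · exact (h1 (S hab)).symm
      · rfl
    have cases2 : ∀ a b, a = k ∨ a = l → b = k ∨ b = l → α.r (Sum.inr a) (Sum.inr b) →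
        (h a ↔ h b) := by
      rintro a b (rfl | rfl) (rfl | rfl) hab
      · rfl
      · rw [← gi, ← gj]; exact h2 hab
      · rw [← gi, ← gj]; exact (h2 (S hab)).symm
      · rfl
    by_cases hx : x = Sum.inl i ∨ x = Sum.inl j
    · have hy : y = Sum.inl i ∨ y = Sum.inl j := by
        rcases hx with rfl | rfl
        · exact hi _ hxy
        · exact hj _ hxy
      rcases hx with rfl | rfl <;> rcases hy with rfl | rfl <;>
        exact cases1 _ _ (by simp) (by simp) hxy
    · by_cases hx' : x = Sum.inr k ∨ x = Sum.inr l
      · have hy : y = Sum.inr k ∨ y = Sum.inr l := by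
          rcases hx' with rfl | rfl
          · exact hk _ hxy
          · exact hl _ hxy
        rcases hx' with rfl | rfl <;> rcases hy with rfl | rfl <;>
          exact cases2 _ _ (by simp) (by simp) hxy
      · have hy : ¬ (y = Sum.inl i ∨ y = Sum.inl j) := by
          rintro (rfl | rfl)
          · exact hx (hi _ (S hxy))
          · exact hx (hj _ (S hxy))
        have hy' : ¬ (y = Sum.inr k ∨ y = Sum.inr l) := by
          rintro (rfl | rfl)
          · exact hx' (hk _ (S hxy))
          · exact hx' (hl _ (S hxy))
        push Not at hx hy hx' hy'
        rw [ag x hx.1 hx.2, ag y hy.1 hy.2]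
        apply h4
        simp only [jn_r]
        right
        refine ⟨by simp [hx, hx'], by simp [hy, hy'], Or.inr ⟨by simp [hx, hx'], by simp [hy, hy'], hxy⟩⟩

theorem ncard_dom {α : Dgm n} (hα : IsPB α) : (domSet α).ncard = (codomSet α).ncard := by
  have S := @α.iseqv.symm
  have T := @α.iseqv.trans
  refine Set.ncard_congr (fun i hi => Classical.choose hi) ?_ ?_ ?_
  · intro i hi
    exact ⟨i, S (Classical.choose_spec hi)⟩
  · intro a b ha hb hab
    have h1 := Classical.choose_spec ha
    have h2 := Classical.choose_spec hb
    rw [hab] at h1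
    have := hα _ _ _ h1 (T h1 (S h2))
    simpa using this
  · rintro k ⟨i, hi⟩
    have hd : i ∈ domSet α := ⟨k, S hi⟩
    refine ⟨i, hd, ?_⟩
    have h1 := Classical.choose_spec hd
    have := hα _ _ _ h1 (S hi)
    simpa using this

theorem ncard_compl {α : Dgm n} (hα : IsPB α) : (domSet α)ᶜ.ncard = (codomSet α)ᶜ.ncard := by
  rw [Set.ncard_compl, Set.ncard_compl, ncard_dom hα]

theorem step3 (G : Dgm n → Prop) (hmul : ∀ a b, G a → G b → G (a * b))
    {α P : Dgm n} (hα : IsPB α)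
    (IH : ∀ β : Dgm n, IsPB β → (domSet β)ᶜ.ncard < (domSet α)ᶜ.ncard → G β)
    {i j k l : Fin n} (hijkl : i = j ↔ k = l)
    (hi : ∀ z, α.r (Sum.inl i) z → z = Sum.inl i ∨ z = Sum.inl j)
    (hj : ∀ z, α.r (Sum.inl j) z → z = Sum.inl i ∨ z = Sum.inl j)
    (hk : ∀ z, α.r (Sum.inr k) z → z = Sum.inr k ∨ z = Sum.inr l)
    (hl : ∀ z, α.r (Sum.inr l) z → z = Sum.inr k ∨ z = Sum.inr l)
    (hP : ∀ f g, Rc P f g ↔ (α.r (Sum.inl i) (Sum.inl j) → (f i ↔ f j)) ∧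
      (α.r (Sum.inr k) (Sum.inr l) → (g i ↔ g j)) ∧ ∀ a, a ≠ i → a ≠ j → (f a ↔ g a))
    (hG : G P) : G α := by
  rw [step2 hijkl hi hj hk hl hP]
  apply hmul _ _ hG
  apply IH _ (jn_PB (jn_PB hα _ _) _ _)
  have di : i ∉ domSet α := by rintro ⟨m, hm⟩; simpa using hi _ hm
  have dj : j ∉ domSet α := by rintro ⟨m, hm⟩; simpa using hj _ hm
  have dk : k ∉ codomSet α := by rintro ⟨m, hm⟩; simpa using hk _ hm
  have dl : l ∉ codomSet α := by rintro ⟨m, hm⟩; simpa using hl _ hm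
  apply Set.ncard_lt_ncard
  · change _ < _
    rw [compl_lt_compl_iff_lt]
    refine ⟨?_, fun h => dj (h jn_dom_self)⟩
    by_cases hij : i = j
    · have hkl := hijkl.1 hij
      subst hij; subst hkl
      rintro m ⟨q, hq⟩
      have h1 : m ≠ i := by rintro rfl; exact di ⟨q, hq⟩
      have h2 : q ≠ k := by rintro rfl; exact dk ⟨m, α.iseqv.symm hq⟩
      refine ⟨q, ?_⟩
      simp [jn_r, h1, h2, hq]
    · have hkl : l ≠ k := fun h => hij (hijkl.2 h.symm)
      exact (jn_dom di dk).trans (jn_dom (jn_dom_not dj (Ne.symm hij)) (jn_codom_not dl hkl))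
  · exact Set.toFinite _

theorem gen_all (G : Dgm n → Prop) (hmul : ∀ a b, G a → G b → G (a * b))
    (hperm : ∀ π, G (permD π)) (heps : ∀ i, G (eps i)) (htau : ∀ i j, i ≠ j → G (tau i j))
    (α : Dgm n) (hα : IsPB α) : G α := by
  induction hN : (domSet α)ᶜ.ncard using Nat.strong_induction_on generalizing α with
  | _ N ihN =>
  have IH : ∀ β : Dgm n, IsPB β → (domSet β)ᶜ.ncard < (domSet α)ᶜ.ncard → G β := by
    intro β h1 h2
    exact ihN _ (hN ▸ h2) β h1 rfl
  have S := @α.iseqv.symm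
  by_cases hall : ∀ i, i ∈ domSet α
  · obtain ⟨π, rfl⟩ := eq_perm hα hall
    exact hperm π
  push Not at hall
  obtain ⟨i, hi⟩ := hall
  -- upper and lower structure
  have U : ∀ i, i ∉ domSet α → (∀ a b, α.r (Sum.inl a) (Sum.inl b) → a = b) →
      ∀ z, α.r (Sum.inl i) z → z = Sum.inl i := by
    rintro i hi hno (z | z) hz
    · rw [hno _ _ hz]
    · exact (hi ⟨z, hz⟩).elim
  have D : ∀ i, i ∉ codomSet α → (∀ a b, α.r (Sum.inr a) (Sum.inr b) → a = b) →
      ∀ z, α.r (Sum.inr i) z → z = Sum.inr i := by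
    rintro i hi hno (z | z) hz
    · exact (hi ⟨z, hz⟩).elim
    · rw [hno _ _ hz]
  have pair : ∀ a b : PBV n, a ≠ b → α.r a b → ∀ z, α.r a z → z = a ∨ z = b := by
    intro a b hab h z hz
    have := hα a b z h hz
    grind
  by_cases hU : ∃ i j, i ≠ j ∧ α.r (Sum.inl i) (Sum.inl j)
  · obtain ⟨i, j, hij, hr⟩ := hU
    have pi := pair (Sum.inl i) (Sum.inl j) (by simpa using hij) hr
    have pj := pair (Sum.inl j) (Sum.inl i) (by simpa using hij.symm) (S hr)
    have pj' : ∀ z, α.r (Sum.inl j) z → z = Sum.inl i ∨ z = Sum.inl j :=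
      fun z hz => (pj z hz).symm
    by_cases hD : ∃ k l, k ≠ l ∧ α.r (Sum.inr k) (Sum.inr l)
    · obtain ⟨k, l, hkl, hr'⟩ := hD
      have pk := pair (Sum.inr k) (Sum.inr l) (by simpa using hkl) hr'
      have pl := pair (Sum.inr l) (Sum.inr k) (by simpa using hkl.symm) (S hr')
      refine step3 G hmul hα IH (P := tau i j) (by simp [hij, hkl]) pi pj' pk
        (fun z hz => (pl z hz).symm) ?_ (htau i j hij)
      intro f g
      simp [Rc_tau hij, hr, hr']
    · have hno : ∀ a b, α.r (Sum.inr a) (Sum.inr b) → a = b := by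
        intro a b hab; by_contra hne; exact hD ⟨a, b, hne, hab⟩
      have two : 1 < (codomSet α)ᶜ.ncard := by
        rw [← ncard_compl hα, Set.one_lt_ncard_iff (Set.toFinite _)]
        refine ⟨i, j, ?_, ?_, hij⟩
        · rintro ⟨m, hm⟩; simpa using pi _ hm
        · rintro ⟨m, hm⟩; simpa using pj _ hm
      rw [Set.one_lt_ncard_iff (Set.toFinite _)] at two
      obtain ⟨k, l, hk, hl, hkl⟩ := two
      refine step3 G hmul hα IH (P := tau i j * (eps i * eps j)) (by simp [hij, hkl]) pi pj'
        (fun z hz => Or.inl (D k hk hno z hz)) (fun z hz => Or.inr (D l hl hno z hz)) ?_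
        (hmul _ _ (htau i j hij) (hmul _ _ (heps i) (heps j)))
      intro f g
      have : ¬ α.r (Sum.inr k) (Sum.inr l) := fun h => hkl (hno _ _ h)
      simp only [Rc_mul', Rc_tau hij, Rc_eps, hr, this]
      constructor
      · rintro ⟨a, ⟨h1, h2, h3⟩, b, h4, h5⟩
        refine ⟨fun _ => h1, fun h => h.elim, fun m hm hm' => ?_⟩
        rw [h3 m hm hm', h4 m hm, h5 m hm']
      · rintro ⟨h1, -, h3⟩
        refine ⟨fun m => if m = i ∨ m = j then False else f m, ⟨h1 trivial, by simp, ?_⟩,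
          fun m => if m = i then g m else if m = j then False else f m, ?_, ?_⟩
        · intro m hm hm'; simp [hm, hm']
        · intro m hm; simp [hm]
        · intro m hm
          by_cases hmi : m = i
          · simp [hmi]
          · simp [hmi, hm, h3 m hmi hm]
  · have hno : ∀ a b, α.r (Sum.inl a) (Sum.inl b) → a = b := by
      intro a b hab; by_contra hne; exact hU ⟨a, b, hne, hab⟩
    by_cases hD : ∃ k l, k ≠ l ∧ α.r (Sum.inr k) (Sum.inr l)
    · obtain ⟨k, l, hkl, hr'⟩ := hD
      have pk := pair (Sum.inr k) (Sum.inr l) (by simpa using hkl) hr'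
      have pl := pair (Sum.inr l) (Sum.inr k) (by simpa using hkl.symm) (S hr')
      have two : 1 < (domSet α)ᶜ.ncard := by
        rw [ncard_compl hα, Set.one_lt_ncard_iff (Set.toFinite _)]
        refine ⟨k, l, ?_, ?_, hkl⟩
        · rintro ⟨m, hm⟩; simpa using pk _ hm
        · rintro ⟨m, hm⟩; simpa using pl _ hm
      rw [Set.one_lt_ncard_iff (Set.toFinite _)] at two
      obtain ⟨i, j, hi, hj, hij⟩ := two
      refine step3 G hmul hα IH (P := (eps i * eps j) * tau i j) (by simp [hij, hkl])
        (fun z hz => Or.inl (U i hi hno z hz)) (fun z hz => Or.inr (U j hj hno z hz))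
        pk (fun z hz => (pl z hz).symm) ?_
        (hmul _ _ (hmul _ _ (heps i) (heps j)) (htau i j hij))
      intro f g
      have : ¬ α.r (Sum.inl i) (Sum.inl j) := fun h => hij (hno _ _ h)
      simp only [Rc_mul', Rc_tau hij, Rc_eps, hr', this]
      constructor
      · rintro ⟨b, ⟨a, h4, h5⟩, h1, h2, h3⟩
        refine ⟨fun h => h.elim, fun _ => h2, fun m hm hm' => ?_⟩
        rw [h4 m hm, h5 m hm', h3 m hm hm']
      · rintro ⟨-, h1, h3⟩
        refine ⟨fun m => if m = i ∨ m = j then False else f m,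
          ⟨fun m => if m = i then False else f m, ?_, ?_⟩, by simp, h1 trivial, ?_⟩
        · intro m hm; simp [hm]
        · intro m hm; simp [hm]
        · intro m hm hm'; simp [hm, hm', h3 m hm hm']
    · have hno' : ∀ a b, α.r (Sum.inr a) (Sum.inr b) → a = b := by
        intro a b hab; by_contra hne; exact hD ⟨a, b, hne, hab⟩
      have one : 0 < (codomSet α)ᶜ.ncard := by
        rw [← ncard_compl hα, Set.ncard_pos (Set.toFinite _)]
        exact ⟨i, hi⟩
      rw [Set.ncard_pos (Set.toFinite _)] at one
      obtain ⟨k, hk⟩ := one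
      refine step3 G hmul hα IH (P := eps i) (i := i) (j := i) (k := k) (l := k) (by simp)
        (fun z hz => Or.inl (U i hi hno z hz)) (fun z hz => Or.inl (U i hi hno z hz))
        (fun z hz => Or.inl (D k hk hno' z hz)) (fun z hz => Or.inl (D k hk hno' z hz)) ?_ (heps i)
      intro f g
      simp [Rc_eps]

theorem eps_conj (σ : Equiv.Perm (Fin n)) (i : Fin n) :
    eps i = permD σ * eps (σ i) * permD σ⁻¹ := by
  apply Rc_inj
  intro f g
  simp only [Rc_mul', Rc_eps, Rc_perm]
  constructor
  · intro h
    refine ⟨fun m => g (σ⁻¹ m), ⟨fun m => f (σ⁻¹ m), by simp, ?_⟩, by simp⟩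
    intro a ha
    apply h
    rintro rfl
    simp at ha
  · rintro ⟨b, ⟨a, h1, h2⟩, h3⟩ m hm
    rw [h1, h2, h3]
    · simp
    · simpa using hm

theorem tau_conj (σ : Equiv.Perm (Fin n)) (i j : Fin n) (hij : i ≠ j) :
    tau i j = permD σ * tau (σ i) (σ j) * permD σ⁻¹ := by
  have hij' : σ i ≠ σ j := by simpa using hij
  apply Rc_inj
  intro f g
  simp only [Rc_mul', Rc_tau hij, Rc_tau hij', Rc_perm]
  constructor
  · rintro ⟨h1, h2, h⟩
    refine ⟨fun m => g (σ⁻¹ m), ⟨fun m => f (σ⁻¹ m), by simp, by simpa using h1,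
      by simpa using h2, ?_⟩, by simp⟩
    intro a ha hb
    apply h
    · rintro rfl; simp at ha
    · rintro rfl; simp at hb
  · rintro ⟨b, ⟨a, h1, h4, h5, h2⟩, h3⟩
    refine ⟨?_, ?_, ?_⟩
    · rw [h1, h1]; exact h4
    · simpa [h3] using h5
    · intro m hm hm'
      rw [h1, h2, h3]
      · simp
      · simpa using hm
      · simpa using hm'

theorem eps_all (G : Dgm n → Prop) (hmul : ∀ a b, G a → G b → G (a * b))
    (hperm : ∀ π, G (permD π)) (i0 : Fin n) (h : G (eps i0)) (i : Fin n) : G (eps i) := by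
  rw [eps_conj (Equiv.swap i i0) i, Equiv.swap_apply_left]
  exact hmul _ _ (hmul _ _ (hperm _) h) (hperm _)

theorem tau_all (G : Dgm n → Prop) (hmul : ∀ a b, G a → G b → G (a * b))
    (hperm : ∀ π, G (permD π)) (i0 j0 : Fin n) (h0 : i0 ≠ j0) (h : G (tau i0 j0))
    (i j : Fin n) (hij : i ≠ j) : G (tau i j) := by
  obtain ⟨σ, h1, h2⟩ : ∃ σ : Equiv.Perm (Fin n), σ i = i0 ∧ σ j = j0 := by
    refine ⟨Equiv.swap (Equiv.swap i i0 j) j0 * Equiv.swap i i0, ?_, ?_⟩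
    · rw [Equiv.Perm.mul_apply, Equiv.swap_apply_left]
      apply Equiv.swap_apply_of_ne_of_ne _ h0
      intro h
      have : Equiv.swap i i0 i = Equiv.swap i i0 j := by rw [Equiv.swap_apply_left]; exact h
      exact hij (Equiv.injective _ this)
    · rw [Equiv.Perm.mul_apply, Equiv.swap_apply_left]
  rw [tau_conj σ i j hij, h1, h2]
  exact hmul _ _ (hmul _ _ (hperm _) h) (hperm _)

theorem perm_all (G : Dgm n → Prop) (hmul : ∀ a b, G a → G b → G (a * b))
    (s : Set (Equiv.Perm (Fin n))) (hne : s.Nonempty) (hs : ∀ π ∈ s, G (permD π))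
    (htop : Subgroup.closure s = ⊤) (π : Equiv.Perm (Fin n)) : G (permD π) := by
  have pw : ∀ π, G (permD π) → ∀ k, G (permD (π ^ (k + 1))) := by
    intro π hπ k
    induction k with
    | zero => simpa using hπ
    | succ k ih =>
      rw [pow_succ', ← permD_mul]
      exact hmul _ _ ih hπ
  have hπ : π ∈ Subgroup.closure s := by rw [htop]; trivial
  induction hπ using Subgroup.closure_induction with
  | mem x hx => exact hs x hx
  | one =>
    obtain ⟨a, ha⟩ := hne
    have := pw a (hs a ha) (orderOf a - 1)
    rwa [Nat.sub_add_cancel (orderOf_pos a), pow_orderOf_eq_one] at this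
  | mul x y _ _ hx hy =>
    rw [← permD_mul]; exact hmul _ _ hy hx
  | inv x _ hx =>
    have hp := orderOf_pos x
    have := pw x hx (2 * orderOf x - 2)
    have e : x ^ (2 * orderOf x - 2 + 1) = x⁻¹ := by
      apply eq_inv_of_mul_eq_one_left
      rw [← pow_succ, show 2 * orderOf x - 2 + 1 + 1 = orderOf x * 2 by omega, pow_mul,
        pow_orderOf_eq_one, one_pow]
    rwa [e] at this

theorem genSet_eq {X : Set (Dgm n)}
    (hX : ∀ x ∈ X, (∃ π, x = permD π) ∨ (∃ i, x = eps i) ∨ ∃ i j, x = tau i j)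
    (s : Set (Equiv.Perm (Fin n))) (hne : s.Nonempty) (hs : ∀ π ∈ s, permD π ∈ X)
    (htop : Subgroup.closure s = ⊤)
    (he : ∀ i : Fin n, ∃ i0 : Fin n, eps i0 ∈ X)
    (ht : ∀ i j : Fin n, i ≠ j → ∃ i0 j0 : Fin n, i0 ≠ j0 ∧ tau i0 j0 ∈ X) :
    genSet pmul X = PBset n := by
  ext α
  constructor
  · intro h
    have : ∀ β, IsPB β → IsPB (α * β) := by
      induction h with
      | base hx =>
        intro β hβ
        rcases hX _ hx with ⟨π, rfl⟩ | ⟨i, rfl⟩ | ⟨i, j, rfl⟩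
        · exact isPB_perm_mul π hβ
        · exact isPB_eps_mul i hβ
        · exact isPB_tau_mul i j hβ
      | @mul x y _ _ h1 h2 =>
        intro β hβ
        rw [← mul_def, mul_assoc]
        exact h1 _ (h2 _ hβ)
    have := this 1 isPB_one
    rwa [mul_one] at this
  · intro hα
    have hmul : ∀ a b : Dgm n, MClo pmul X a → MClo pmul X b → MClo pmul X (a * b) :=
      fun a b => MClo.mul
    have hperm := perm_all (MClo pmul X) hmul s hne (fun π hπ => MClo.base (hs π hπ)) htop
    refine gen_all (MClo pmul X) hmul hperm ?_ ?_ α hα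
    · intro i
      obtain ⟨i0, h0⟩ := he i
      exact eps_all _ hmul hperm i0 (MClo.base h0) i
    · intro i j hij
      obtain ⟨i0, j0, h0, h1⟩ := ht i j hij
      exact tau_all _ hmul hperm i0 j0 h0 (MClo.base h1) i j hij

theorem upper (n : ℕ) : ∃ X : Finset (Dgm n), X.card ≤ (if n ≤ 2 then n + 1 else 4) ∧
    genSet pmul (X : Set (Dgm n)) = PBset n := by
  match n with
  | 0 =>
    refine ⟨{permD 1}, by simp, genSet_eq (by simp) {1} (by simp) (by simp) ?_ ?_ ?_⟩
    · exact Subsingleton.elim _ _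
    · intro i; exact i.elim0
    · intro i; exact i.elim0
  | 1 =>
    refine ⟨{permD 1, eps 0}, by simpa using Finset.card_le_two, genSet_eq ?_ {1} (by simp) (by simp) ?_ ?_ ?_⟩
    · simp only [Finset.coe_insert, Finset.coe_singleton]
      rintro x (rfl | rfl)
      · exact Or.inl ⟨_, rfl⟩
      · exact Or.inr (Or.inl ⟨_, rfl⟩)
    · exact Subsingleton.elim _ _
    · intro i; exact ⟨0, by simp⟩
    · intro i j hij; exact (hij (Subsingleton.elim _ _)).elim
  | m + 2 =>
    refine ⟨{permD (finRotate (m + 2)), permD (Equiv.swap 0 (finRotate (m + 2) 0)), eps 0, tau 0 1}, ?_,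
      genSet_eq ?_ {finRotate (m + 2), Equiv.swap 0 (finRotate (m + 2) 0)} (by simp) (by simp) ?_ ?_ ?_⟩
    · match m with
      | 0 =>
        have : finRotate 2 = Equiv.swap 0 (finRotate 2 0) := by decide
        rw [← this]
        simpa using Finset.card_le_three
      | m + 1 =>
        simpa using Finset.card_le_four
    · simp only [Finset.coe_insert, Finset.coe_singleton]
      rintro x (rfl | rfl | rfl | rfl)
      · exact Or.inl ⟨_, rfl⟩
      · exact Or.inl ⟨_, rfl⟩
      · exact Or.inr (Or.inl ⟨_, rfl⟩)
      · exact Or.inr (Or.inr ⟨_, _, rfl⟩)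
    · exact Equiv.Perm.closure_cycle_adjacent_swap isCycle_finRotate support_finRotate 0
    · intro i; exact ⟨0, by simp⟩
    · intro i j _; exact ⟨0, 1, by simp, by simp⟩

theorem exists_gen {X : Set (Dgm n)} (P : Dgm n → Prop)
    (hP : ∀ a b, a ∈ genSet pmul X → b ∈ genSet pmul X → P a → P b → P (a * b))
    {α : Dgm n} (h : α ∈ genSet pmul X) (hα : ¬ P α) : ∃ x ∈ X, ¬ P x := by
  by_contra hc
  push Not at hc
  apply hα
  clear hα
  induction h with
  | base hx => exact hc _ hx
  | @mul x y hx hy h1 h2 => exact hP _ _ hx hy h1 h2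

theorem isPB_perm (π : Equiv.Perm (Fin n)) : IsPB (permD π) := by
  have := isPB_perm_mul π isPB_one
  rwa [mul_one] at this

theorem isPB_eps (i : Fin n) : IsPB (eps i) := by
  have := isPB_eps_mul i isPB_one
  rwa [mul_one] at this

theorem isPB_tau (i j : Fin n) : IsPB (tau i j) := by
  have := isPB_tau_mul i j isPB_one
  rwa [mul_one] at this

theorem not_idpt (hn : 2 ≤ n) : ¬ IdptGen (pmul (n := n)) (PBset n) := by
  intro h
  unfold IdptGen at h
  let s : Equiv.Perm (Fin n) := Equiv.swap ⟨0, by omega⟩ ⟨1, by omega⟩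
  have hs : s ≠ 1 := by
    intro h
    have : s ⟨0, by omega⟩ = ⟨1, by omega⟩ := Equiv.swap_apply_left _ _
    rw [h] at this
    simp at this
  have hm : permD s ∈ genSet pmul {x ∈ PBset n | pmul x x = x} := by
    rw [h]; exact isPB_perm s
  have key := exists_gen (fun x => IsUnit x → x = 1) ?_ hm ?_
  · obtain ⟨x, ⟨-, hx⟩, hx'⟩ := key
    apply hx'
    intro hu
    have : x * x = x * 1 := by rw [mul_one]; exact hx
    exact hu.mul_left_cancel this
  · intro a b _ _ ha hb hu
    rw [ha (isUnit_left hu), hb (isUnit_right hu), one_mul]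
  · intro h
    exact hs (permD_inj (h (isUnit_permD s)))

variable {X : Set (Dgm n)}

theorem ex_unit (hX : genSet pmul X = PBset n) : ∃ u ∈ X, IsUnit u := by
  obtain ⟨x, h1, h2⟩ := exists_gen (X := X) (fun x => ¬ IsUnit x)
    (fun a b _ _ ha _ h => ha (isUnit_left h)) (α := 1) (by rw [hX]; exact isPB_one)
    (fun h => h isUnit_one)
  exact ⟨x, h1, not_not.1 h2⟩

theorem ex_two_units (hX : genSet pmul X = PBset n) (hn : 3 ≤ n) :
    ∃ u ∈ X, ∃ v ∈ X, u ≠ v ∧ IsUnit u ∧ IsUnit v := by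
  obtain ⟨u, hu, hu'⟩ := ex_unit hX
  have : ∃ π : Equiv.Perm (Fin n), ¬ ∃ k : ℕ, permD π = u ^ k := by
    by_contra hc
    push Not at hc
    obtain ⟨k, hk⟩ := hc (Equiv.swap ⟨0, by omega⟩ ⟨1, by omega⟩)
    obtain ⟨l, hl⟩ := hc (Equiv.swap ⟨1, by omega⟩ ⟨2, by omega⟩)
    have h1 : u ^ k * u ^ l = u ^ l * u ^ k := by rw [← pow_add, ← pow_add, add_comm]
    rw [← hk, ← hl, permD_mul, permD_mul] at h1
    have h2 := congrArg (fun σ => σ ⟨0, by omega⟩) (permD_inj h1)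
    simp [Equiv.swap_apply_def] at h2
  obtain ⟨π, hπ⟩ := this
  have key := exists_gen (X := X) (fun x => IsUnit x → ∃ k : ℕ, x = u ^ k) ?_
    (α := permD π) (by rw [hX]; exact isPB_perm π) (fun h => hπ (h (isUnit_permD π)))
  · obtain ⟨v, hv, hv'⟩ := key
    push Not at hv'
    refine ⟨u, hu, v, hv, ?_, hu', hv'.1⟩
    rintro rfl
    exact hv'.2 1 (by simp)
  · intro a b _ _ ha hb hab
    obtain ⟨k, rfl⟩ := ha (isUnit_left hab)
    obtain ⟨l, rfl⟩ := hb (isUnit_right hab)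
    exact ⟨k + l, (pow_add _ _ _).symm⟩

theorem eps_dom {i j : Fin n} (h : j ≠ i) : j ∈ domSet (eps i) := by
  refine ⟨j, ?_⟩
  change (_, _) = (_, _)
  simp [h]

theorem eps_not_unit (i : Fin n) : ¬ IsUnit (eps i) := by
  intro h
  obtain ⟨k, hk⟩ := dom_unit h i
  have : (i, decide (i = i)) = (k, false) := hk
  simp at this

theorem ex_eps (hX : genSet pmul X = PBset n) (hn : 1 ≤ n) :
    ∃ u ∈ X, ¬ IsUnit u ∧ ∀ i j, i ≠ j → i ∉ domSet u → j ∈ domSet u := by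
  have key := exists_gen (X := X)
    (fun x => IsUnit x ∨ ∃ i j, i ≠ j ∧ i ∉ domSet x ∧ j ∉ domSet x) ?_
    (α := eps ⟨0, hn⟩) (by rw [hX]; exact isPB_eps _) ?_
  · obtain ⟨u, hu, hu'⟩ := key
    push Not at hu'
    exact ⟨u, hu, hu'⟩
  · intro a b ha _ h1 h2
    rcases h1 with h1 | ⟨i, j, hij, hi, hj⟩
    · rcases h2 with h2 | ⟨i, j, hij, hi, hj⟩
      · exact Or.inl (h1.mul h2)
      · rw [hX] at ha
        obtain ⟨π, rfl⟩ := eq_perm ha (dom_unit h1)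
        refine Or.inr ⟨π⁻¹ i, π⁻¹ j, by simpa using hij, fun h => hi ?_, fun h => hj ?_⟩
        · simpa using dom_perm_mul h
        · simpa using dom_perm_mul h
    · exact Or.inr ⟨i, j, hij, fun h => hi (dom_mul h), fun h => hj (dom_mul h)⟩
  · rintro (h | ⟨i, j, hij, hi, hj⟩)
    · exact eps_not_unit _ h
    · by_cases h : i = ⟨0, hn⟩
      · exact hj (eps_dom (fun h' => hij (h.trans h'.symm)))
      · exact hi (eps_dom h)

theorem ex_tau (hX : genSet pmul X = PBset n) (hn : 2 ≤ n) :
    ∃ u ∈ X, ¬ IsUnit u ∧ ∃ i j, i ≠ j ∧ i ∉ domSet u ∧ j ∉ domSet u := by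
  obtain ⟨u, hu, hu'⟩ := exists_gen (X := X) Tot (fun a b _ _ ha hb => ha.mul hb)
    (α := tau ⟨0, by omega⟩ ⟨1, by omega⟩) (by rw [hX]; exact isPB_tau _ _)
    (tau_not_tot (by simp))
  refine ⟨u, hu, fun h => hu' (isUnit_tot h), ?_⟩
  obtain ⟨i, j, hij, hr⟩ := not_tot hu'
  have hPB : IsPB u := by
    have : u ∈ genSet pmul X := MClo.base hu
    rw [hX] at this
    exact this
  refine ⟨i, j, hij, ?_, ?_⟩
  · rintro ⟨k, hk⟩
    have := hPB _ _ _ hr hk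
    simp [hij] at this
  · rintro ⟨k, hk⟩
    have := hPB _ _ _ (u.iseqv.symm hr) hk
    simp [hij.symm] at this

theorem lower_bd {X : Finset (Dgm n)} (hX : genSet pmul (X : Set (Dgm n)) = PBset n) :
    (if n ≤ 2 then n + 1 else 4) ≤ X.card := by
  have sub : ∀ Y : Finset (Dgm n), (∀ y ∈ Y, y ∈ X) → Y.card ≤ X.card :=
    fun Y h => Finset.card_le_card h
  obtain ⟨u, hu, hu'⟩ := ex_unit hX
  rcases Nat.lt_or_ge n 1 with h | hn1
  · have := sub {u} (by simpa using hu)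
    rw [Finset.card_singleton] at this
    split_ifs <;> omega
  obtain ⟨e, he, he1, he2⟩ := ex_eps hX hn1
  have hue : u ≠ e := by rintro rfl; exact he1 hu'
  rcases Nat.lt_or_ge n 2 with h | hn2
  · have := sub {u, e} (by
      intro y hy
      simp only [Finset.mem_insert, Finset.mem_singleton] at hy
      rcases hy with rfl | rfl <;> assumption)
    rw [Finset.card_pair hue] at this
    split_ifs <;> omega
  obtain ⟨t, ht, ht1, i, j, hij, hi, hj⟩ := ex_tau hX hn2
  have hut : u ≠ t := by rintro rfl; exact ht1 hu'
  have het : e ≠ t := by rintro rfl; exact hj (he2 i j hij hi)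
  rcases Nat.lt_or_ge n 3 with h | hn3
  · have := sub {u, e, t} (by
      intro y hy
      simp only [Finset.mem_insert, Finset.mem_singleton] at hy
      rcases hy with rfl | rfl | rfl <;> assumption)
    rw [Finset.card_eq_three.2 ⟨u, e, t, hue, hut, het, rfl⟩] at this
    split_ifs <;> omega
  obtain ⟨v, hv, w, hw, hvw, hv', hw'⟩ := ex_two_units hX hn3
  have h1 : v ≠ e := by rintro rfl; exact he1 hv'
  have h2 : v ≠ t := by rintro rfl; exact ht1 hv'
  have h3 : w ≠ e := by rintro rfl; exact he1 hw'
  have h4 : w ≠ t := by rintro rfl; exact ht1 hw'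
  have := sub {v, w, e, t} (by
      intro y hy
      simp only [Finset.mem_insert, Finset.mem_singleton] at hy
      rcases hy with rfl | rfl | rfl | rfl <;> assumption)
  rw [Finset.card_insert_of_notMem (by simp [hvw, h1, h2]),
    Finset.card_eq_three.2 ⟨w, e, t, h3, h4, het, rfl⟩] at this
  split_ifs <;> omega

end PBproof

/-- For `n ≥ 2` the partial Brauer monoid `PB_n` is not
idempotent-generated; moreover `rank(PB_n) = n + 1` for `n ≤ 2` and
`rank(PB_n) = 4` for `n ≥ 3`. -/
theorem rank_PB :
    (∀ n : ℕ, 2 ≤ n → ¬ IdptGen (pmul (n := n)) (PBset n)) ∧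
    (∀ n : ℕ, rnk (pmul (n := n)) (PBset n) = if n ≤ 2 then n + 1 else 4) := by
  refine ⟨fun n hn => PBproof.not_idpt hn, fun n => ?_⟩
  obtain ⟨X, hX, hX'⟩ := PBproof.upper n
  have mem : X.card ∈ {k | ∃ X : Finset (Dgm n), X.card = k ∧ genSet pmul (X : Set (Dgm n)) = PBset n} :=
    ⟨X, rfl, hX'⟩
  apply le_antisymm
  · exact (Nat.sInf_le mem).trans hX
  · apply le_csInf ⟨X.card, mem⟩
    rintro k ⟨Y, rfl, hY⟩
    exact PBproof.lower_bd hY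
end
end

section
/- For n ≥ 2, the idempotent-generated subsemigroup of PB_n satisfies ⟨E(PB_n)⟩ = E(D_n(PB_n) ∪ D_{n−1}(PB_n)) ∪ I_{n−2}(PB_n), and rank(⟨E(PB_n)⟩) = idrank(⟨E(PB_n)⟩) = 1 + C(n+1,2). -/
/-!
Partial Brauer diagrams on `n` points are formalized as set partitions
(equivalence relations, i.e. `Setoid`s) of the vertex set
`{1,…,n} ∪ {1',…,n'}`, encoded as `Fin n ⊕ Fin n`
(`Sum.inl i` is the upper vertex `i`, `Sum.inr i` is the lower vertex `i'`),
all of whose blocks have size at most 2.  The product of two diagrams is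
defined via connectivity (paths) in the product graph, and the involution `*`
by interchanging the two rows of vertices.
-/

noncomputable section

open scoped Classical

open Dgm
namespace Dgm

/-- `f` is the partner map of `α`. -/
def Rep {n : ℕ} (α : Dgm n) (f : PBV n → PBV n) : Prop :=
  ∀ x y, α.r x y ↔ (y = x ∨ y = f x)

theorem Rep.invol {n : ℕ} {α : Dgm n} {f : PBV n → PBV n} (h : Rep α f) (x : PBV n) :
    f (f x) = x := by
  have h1 : α.r x (f x) := (h _ _).2 (Or.inr rfl)
  rcases (h _ _).1 (α.iseqv.symm h1) with h2 | h2
  · rw [← h2]; exact h2.symm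
  · exact h2.symm

theorem Rep.ext {n : ℕ} {α β : Dgm n} {f : PBV n → PBV n} (h : Rep α f) (h' : Rep β f) :
    α = β := by
  apply Setoid.ext
  intro x y
  exact (h x y).trans (h' x y).symm

theorem Rep.isPB {n : ℕ} {α : Dgm n} {f : PBV n → PBV n} (h : Rep α f) : IsPB α := by
  intro x y z h1 h2
  rcases (h _ _).1 h1 with h1 | h1 <;> rcases (h _ _).1 h2 with h2 | h2 <;> simp_all

theorem IsPB.exists_rep {n : ℕ} {α : Dgm n} (h : IsPB α) : ∃ f, Rep α f := by
  have : ∀ x, ∃ z, ∀ y, α.r x y ↔ (y = x ∨ y = z) := by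
    intro x
    by_cases hx : ∃ z, α.r x z ∧ z ≠ x
    · obtain ⟨z, hz, hzx⟩ := hx
      refine ⟨z, fun y => ⟨fun hy => ?_, ?_⟩⟩
      · rcases h x y z hy hz with h | h | h
        · exact Or.inl h.symm
        · exact absurd h.symm hzx
        · exact Or.inr h
      · rintro (rfl | rfl)
        · exact α.iseqv.refl _
        · exact hz
    · push Not at hx
      refine ⟨x, fun y => ⟨fun hy => Or.inl (hx y hy), ?_⟩⟩
      rintro (rfl | rfl) <;> exact α.iseqv.refl _
  choose f hf using this
  exact ⟨f, hf⟩

/-- The diagram of an involution. -/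
def DD {n : ℕ} (f : PBV n → PBV n) (hf : ∀ x, f (f x) = x) : Dgm n where
  r x y := y = x ∨ y = f x
  iseqv := by
    refine ⟨fun _ => Or.inl rfl, ?_, ?_⟩
    · rintro x y (rfl | rfl)
      · exact Or.inl rfl
      · exact Or.inr (hf _).symm
    · rintro x y z (rfl | rfl) (rfl | rfl)
      · exact Or.inl rfl
      · exact Or.inr rfl
      · exact Or.inr rfl
      · exact Or.inl (hf _)

theorem rep_DD {n : ℕ} (f : PBV n → PBV n) (hf : ∀ x, f (f x) = x) : Rep (DD f hf) f :=
  fun _ _ => Iff.rfl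

theorem RGen.inv {V : Type*} {r : V → V → Prop} (Q : V → Prop)
    (hQ : ∀ u v, r u v → (Q u ↔ Q v)) {x y : V} (h : RGen r x y) : Q x ↔ Q y := by
  induction h with
  | rel h => exact hQ _ _ h
  | refl => exact Iff.rfl
  | symm _ ih => exact ih.symm
  | trans _ _ ih1 ih2 => exact ih1.trans ih2

theorem RGen.map {V W : Type*} {r : V → V → Prop} (L : V → W) (s : Setoid W)
    (hL : ∀ u v, r u v → s.r (L u) (L v)) {x y : V} (h : RGen r x y) : s.r (L x) (L y) := by
  induction h with
  | rel h => exact hL _ _ h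
  | refl => exact s.iseqv.refl _
  | symm _ ih => exact s.iseqv.symm ih
  | trans _ _ ih1 ih2 => exact s.iseqv.trans ih1 ih2

/-- Dihedral lemma. -/
theorem dihedral {V : Type*} (a b : Equiv.Perm V) (ha : ∀ v, a (a v) = v)
    (hb : ∀ v, b (b v) = v) (x : V) (hx : b x = x) (r : V → V → Prop)
    (hr : ∀ u v, r u v → v = u ∨ v = a u ∨ v = b u)
    (y z : V) (hy : RGen r x y) (hz : RGen r x z) (hy' : a y = y ∨ b y = y)
    (hz' : a z = z ∨ b z = z) : x = y ∨ x = z ∨ y = z := by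
  have ha2 : a * a = 1 := by ext v; simp [ha]
  have hb2 : b * b = 1 := by ext v; simp [hb]
  have hai : a⁻¹ = a := inv_eq_of_mul_eq_one_left ha2
  have hbi : b⁻¹ = b := inv_eq_of_mul_eq_one_left hb2
  have hca : ∀ k : ℤ, a * (a * b) ^ k = (a * b) ^ (-k) * a := by
    intro k
    have h1 : a * (a * b) * a⁻¹ = (a * b)⁻¹ := by
      rw [mul_inv_rev, hai, hbi, ← mul_assoc, ha2, one_mul]
    have h2 := conj_zpow (i := k) (a := a) (b := a * b)
    rw [h1, inv_zpow'] at h2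
    rw [h2]; simp
  have hcb : ∀ k : ℤ, b * (a * b) ^ k = (a * b) ^ (-k) * b := by
    intro k
    have h1 : b * (a * b) * b⁻¹ = (a * b)⁻¹ := by
      rw [mul_inv_rev, hai, hbi]
      simp [mul_assoc, hb2]
    have h2 := conj_zpow (i := k) (a := b) (b := a * b)
    rw [h1, inv_zpow'] at h2
    rw [h2]; simp
  have hax : a x = (a * b) x := by simp [hx]
  have ea : ∀ k : ℤ, a (((a * b) ^ k) x) = ((a * b) ^ (1 - k)) x := by
    intro k
    have := congrArg (fun p : Equiv.Perm V => p x) (hca k)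
    simp only [Equiv.Perm.mul_apply a ((a*b)^k), Equiv.Perm.mul_apply ((a*b)^(-k)) a] at this
    rw [this, hax, ← Equiv.Perm.mul_apply, ← zpow_add_one]
    congr 2; ring
  have eb : ∀ k : ℤ, b (((a * b) ^ k) x) = ((a * b) ^ (-k)) x := by
    intro k
    have := congrArg (fun p : Equiv.Perm V => p x) (hcb k)
    simp only [Equiv.Perm.mul_apply b ((a*b)^k), Equiv.Perm.mul_apply ((a*b)^(-k)) b] at this
    rw [this, hx]
  set c := a * b with hc
  have key : ∀ v, RGen r x v → ∃ k : ℤ, v = (c ^ k) x := by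
    intro v hv
    have hA : ∀ u, (∃ k : ℤ, u = (c ^ k) x) → ∃ k : ℤ, a u = (c ^ k) x := by
      rintro u ⟨k, rfl⟩; exact ⟨_, ea k⟩
    have hB : ∀ u, (∃ k : ℤ, u = (c ^ k) x) → ∃ k : ℤ, b u = (c ^ k) x := by
      rintro u ⟨k, rfl⟩; exact ⟨_, eb k⟩
    refine (RGen.inv (fun v => ∃ k : ℤ, v = (c ^ k) x) ?_ hv).1 ⟨0, by simp⟩
    intro u v huv
    rcases hr u v huv with rfl | rfl | rfl
    · rfl
    · refine ⟨hA u, fun h => ?_⟩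
      have := hA _ h
      rwa [ha] at this
    · refine ⟨hB u, fun h => ?_⟩
      have := hB _ h
      rwa [hb] at this
  have per : ∀ k l : ℤ, (c ^ k) x = (c ^ l) x ↔
      (Function.minimalPeriod (c • ·) x : ℤ) ∣ (k - l) := by
    intro k l
    rw [← MulAction.zpow_smul_eq_iff_minimalPeriod_dvd, sub_eq_neg_add, zpow_add, zpow_neg,
      Equiv.Perm.smul_def, Equiv.Perm.mul_apply, Equiv.Perm.inv_eq_iff_eq]
  set m : ℤ := (Function.minimalPeriod (c • ·) x : ℤ) with hm
  obtain ⟨k, rfl⟩ := key y hy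
  obtain ⟨l, rfl⟩ := key z hz
  have e0 : x = (c ^ (0 : ℤ)) x := by simp
  rw [ea, eb, per, per] at hy' hz'
  have goal : m ∣ (0 - k) ∨ m ∣ (0 - l) ∨ m ∣ (k - l) := by
    clear_value m
    by_contra hcon
    push Not at hcon
    obtain ⟨h1, h2, h3⟩ := hcon
    rcases hy' with ⟨s, hs⟩ | ⟨s, hs⟩ <;> rcases hz' with ⟨t, ht⟩ | ⟨t, ht⟩
    · -- m odd
      have hmo : ¬ Even m := by
        rintro ⟨q, hq⟩
        have : (q + q) * s = 1 - 2 * k := by rw [← hq]; linarith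
        have h5 : q * s * 2 = 1 - 2 * k := by linarith
        omega
      have h6 : Even (m * (t - s)) := ⟨k - l, by linarith⟩
      rcases Int.even_mul.1 h6 with h7 | ⟨w, hw⟩
      · exact hmo h7
      · exact h3 ⟨w, by rw [hw] at h6; have : m * (t - s) = 2 * (k - l) := by linarith
                        rw [hw] at this; linarith⟩
    · have hmo : ¬ Even m := by
        rintro ⟨q, hq⟩
        have : (q + q) * s = 1 - 2 * k := by rw [← hq]; linarith
        have h5 : q * s * 2 = 1 - 2 * k := by linarith
        omega
      have h6 : Even (m * t) := ⟨-l, by linarith⟩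
      rcases Int.even_mul.1 h6 with h7 | ⟨w, hw⟩
      · exact hmo h7
      · exact h2 ⟨w, by rw [hw] at ht; linarith⟩
    · have hmo : ¬ Even m := by
        rintro ⟨q, hq⟩
        have : (q + q) * t = 1 - 2 * l := by rw [← hq]; linarith
        have h5 : q * t * 2 = 1 - 2 * l := by linarith
        omega
      have h6 : Even (m * s) := ⟨-k, by linarith⟩
      rcases Int.even_mul.1 h6 with h7 | ⟨w, hw⟩
      · exact hmo h7
      · exact h1 ⟨w, by rw [hw] at hs; linarith⟩
    · rcases Int.even_or_odd s with ⟨w, hw⟩ | ⟨w, hw⟩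
      · exact h1 ⟨w, by rw [hw] at hs; linarith⟩
      · rcases Int.even_or_odd t with ⟨w', hw'⟩ | ⟨w', hw'⟩
        · exact h2 ⟨w', by rw [hw'] at ht; linarith⟩
        · exact h3 ⟨w' - w, by rw [hw] at hs; rw [hw'] at ht; linarith⟩
  rcases goal with h | h | h
  · left; rw [← per] at h; simpa using h
  · right; left; rw [← per] at h; simpa using h
  · right; right; rw [← per] at h; exact h

/-- Extension of a partner map to the top and middle rows. -/
def extA {n : ℕ} (f : PBV n → PBV n) : V3 n → V3 n
  | Sum.inl i => topMid (f (Sum.inl i))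
  | Sum.inr (Sum.inl i) => topMid (f (Sum.inr i))
  | Sum.inr (Sum.inr i) => Sum.inr (Sum.inr i)

/-- Extension of a partner map to the middle and bottom rows. -/
def extB {n : ℕ} (f : PBV n → PBV n) : V3 n → V3 n
  | Sum.inl i => Sum.inl i
  | Sum.inr (Sum.inl i) => midBot (f (Sum.inl i))
  | Sum.inr (Sum.inr i) => midBot (f (Sum.inr i))

theorem extA_topMid {n : ℕ} (f : PBV n → PBV n) (x : PBV n) :
    extA f (topMid x) = topMid (f x) := by
  rcases x with x | x <;> rfl

theorem extB_midBot {n : ℕ} (f : PBV n → PBV n) (x : PBV n) :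
    extB f (midBot x) = midBot (f x) := by
  rcases x with x | x <;> rfl

theorem isPB_pmul {n : ℕ} {α β : Dgm n} (hα : IsPB α) (hβ : IsPB β) : IsPB (pmul α β) := by
  obtain ⟨f, hf⟩ := hα.exists_rep
  obtain ⟨g, hg⟩ := hβ.exists_rep
  have hA : ∀ v, extA f (extA f v) = v := by
    rintro (i | i | i)
    · change extA f (topMid (f _)) = _
      rw [extA_topMid, hf.invol]; rfl
    · change extA f (topMid (f _)) = _
      rw [extA_topMid, hf.invol]; rfl
    · rfl
  have hB : ∀ v, extB g (extB g v) = v := by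
    rintro (i | i | i)
    · rfl
    · change extB g (midBot (g _)) = _
      rw [extB_midBot, hg.invol]; rfl
    · change extB g (midBot (g _)) = _
      rw [extB_midBot, hg.invol]; rfl
  let a : Equiv.Perm (V3 n) := Function.Involutive.toPerm _ hA
  let b : Equiv.Perm (V3 n) := Function.Involutive.toPerm _ hB
  have hr : ∀ u v, prodEdges α β u v → v = u ∨ v = a u ∨ v = b u := by
    rintro u v (⟨x, y, h, rfl, rfl⟩ | ⟨x, y, h, rfl, rfl⟩)
    · rcases (hf _ _).1 h with rfl | rfl
      · exact Or.inl rfl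
      · exact Or.inr (Or.inl (extA_topMid f x).symm)
    · rcases (hg _ _).1 h with rfl | rfl
      · exact Or.inl rfl
      · exact Or.inr (Or.inr (extB_midBot g x).symm)
  have hfix : ∀ y : PBV n, a (topBot y) = topBot y ∨ b (topBot y) = topBot y := by
    rintro (i | i)
    · exact Or.inr rfl
    · exact Or.inl rfl
  have hinj : Function.Injective (topBot (n := n)) := by
    rintro (i | i) (j | j) h <;> simp_all [topBot]
  intro x y z h1 h2
  have : topBot x = topBot y ∨ topBot x = topBot z ∨ topBot y = topBot z := by
    rcases hfix x with h | h
    · exact dihedral b a hB hA _ h _ (fun u v h => by have := hr u v h; tauto) _ _ h1 h2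
        (hfix y).symm (hfix z).symm
    · exact dihedral a b hA hB _ h _ hr _ _ h1 h2 (hfix y) (hfix z)
  simpa [hinj.eq_iff] using this

end Dgm

namespace Dgm

/-- Partner map of the generators. -/
def genF {n : ℕ} (k l : Fin n) : PBV n → PBV n
  | Sum.inl m => if m = k then Sum.inl l else if m = l then Sum.inl k else Sum.inr m
  | Sum.inr m => if m = k then Sum.inr l else if m = l then Sum.inr k else Sum.inl m

theorem genF_inl {n : ℕ} (k l m : Fin n) : genF k l (Sum.inl m) =
    if m = k then Sum.inl l else if m = l then Sum.inl k else Sum.inr m := rfl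

theorem genF_inr {n : ℕ} (k l m : Fin n) : genF k l (Sum.inr m) =
    if m = k then Sum.inr l else if m = l then Sum.inr k else Sum.inl m := rfl

theorem genF_invol {n : ℕ} (k l : Fin n) (x : PBV n) : genF k l (genF k l x) = x := by
  rcases x with m | m
  · rw [genF_inl]; split_ifs <;> grind [genF_inl, genF_inr]
  · rw [genF_inr]; split_ifs <;> grind [genF_inl, genF_inr]

/-- The generators. -/
def gen {n : ℕ} (k l : Fin n) : Dgm n := DD (genF k l) (genF_invol k l)

theorem rep_gen {n : ℕ} (k l : Fin n) : Rep (gen k l) (genF k l) := rep_DD _ _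

/-- The identity diagram. -/
def oneD (n : ℕ) : Dgm n := DD swapUD (by rintro (x | x) <;> rfl)

theorem rep_one (n : ℕ) : Rep (oneD n) swapUD := rep_DD _ _

/-- Labels of the top and middle rows. -/
def lamT {n : ℕ} (c : Fin n → PBV n) : PBV n → PBV n
  | Sum.inl a => Sum.inl a
  | Sum.inr m => c m

/-- Labels of the middle and bottom rows. -/
def lamB {n : ℕ} (c : Fin n → PBV n) : PBV n → PBV n
  | Sum.inl m => c m
  | Sum.inr m => Sum.inr m

/-- Labels of all three rows. -/
def lam3 {n : ℕ} (c : Fin n → PBV n) : V3 n → PBV n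
  | Sum.inl a => Sum.inl a
  | Sum.inr (Sum.inl m) => c m
  | Sum.inr (Sum.inr m) => Sum.inr m

theorem edgeA {n : ℕ} {α β : Dgm n} {f : PBV n → PBV n} (hα : Rep α f) (x : PBV n) :
    RGen (prodEdges α β) (topMid x) (topMid (f x)) :=
  RGen.rel (Or.inl ⟨x, f x, (hα _ _).2 (Or.inr rfl), rfl, rfl⟩)

theorem edgeB {n : ℕ} {α β : Dgm n} {f : PBV n → PBV n} (hβ : Rep β f) (x : PBV n) :
    RGen (prodEdges α β) (midBot x) (midBot (f x)) :=
  RGen.rel (Or.inr ⟨x, f x, (hβ _ _).2 (Or.inr rfl), rfl, rfl⟩)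

theorem mulRep' {n : ℕ} {α β : Dgm n} {f h g : PBV n → PBV n} (c : Fin n → PBV n)
    (hα : Rep α f) (hβ : Rep β h) (hg : ∀ x, g (g x) = x)
    (h2 : ∀ x, RGen (prodEdges α β) (topBot x) (topBot (g x)))
    (h3 : ∀ x, lamT c (f x) = lamT c x ∨ lamT c (f x) = g (lamT c x))
    (h4 : ∀ x, lamB c (h x) = lamB c x ∨ lamB c (h x) = g (lamB c x)) :
    Rep (pmul α β) g := by
  have l0 : ∀ x, lam3 c (topBot x) = x := by rintro (x | x) <;> rfl
  have lT : ∀ x, lam3 c (topMid x) = lamT c x := by rintro (x | x) <;> rfl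
  have lB : ∀ x, lam3 c (midBot x) = lamB c x := by rintro (x | x) <;> rfl
  intro x y
  constructor
  · intro hxy
    have := RGen.map (lam3 c) (DD g hg) ?_ hxy
    · rw [l0, l0] at this
      exact this
    · rintro u v (⟨a, b, hab, rfl, rfl⟩ | ⟨a, b, hab, rfl, rfl⟩)
      · rw [lT, lT]
        rcases (hα _ _).1 hab with rfl | rfl
        · exact Or.inl rfl
        · exact h3 a
      · rw [lB, lB]
        rcases (hβ _ _).1 hab with rfl | rfl
        · exact Or.inl rfl
        · exact h4 a
  · rintro (rfl | rfl)
    · exact RGen.refl _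
    · exact h2 x

theorem mulRep {n : ℕ} {α β : Dgm n} {f h g : PBV n → PBV n} (c : Fin n → PBV n)
    (hα : Rep α f) (hβ : Rep β h) (hg : ∀ x, g (g x) = x)
    (h1 : ∀ m, RGen (prodEdges α β) (Sum.inr (Sum.inl m)) (topBot (c m)))
    (h2 : ∀ x, g x = x ∨ (∃ u, x = lamT c u ∧ g x = lamT c (f u)) ∨
      (∃ u, x = lamB c u ∧ g x = lamB c (h u)))
    (h3 : ∀ x, lamT c (f x) = lamT c x ∨ lamT c (f x) = g (lamT c x))
    (h4 : ∀ x, lamB c (h x) = lamB c x ∨ lamB c (h x) = g (lamB c x)) :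
    Rep (pmul α β) g := by
  have hT : ∀ x, RGen (prodEdges α β) (topMid x) (topBot (lamT c x)) := by
    rintro (x | x)
    · exact RGen.refl _
    · exact h1 x
  have hB : ∀ x, RGen (prodEdges α β) (midBot x) (topBot (lamB c x)) := by
    rintro (x | x)
    · exact h1 x
    · exact RGen.refl _
  refine mulRep' c hα hβ hg (fun x => ?_) h3 h4
  rcases h2 x with h | ⟨u, hu, hu'⟩ | ⟨u, hu, hu'⟩
  · rw [h]; exact RGen.refl _
  · rw [hu', hu]
    exact (hT u).symm.trans ((edgeA hα u).trans (hT _))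
  · rw [hu', hu]
    exact (hB u).symm.trans ((edgeB hβ u).trans (hB _))

theorem mul_one_rep {n : ℕ} {α : Dgm n} {f : PBV n → PBV n} (hα : Rep α f) :
    Rep (pmul α (oneD n)) f := by
  refine mulRep Sum.inr hα (rep_one n) hα.invol (fun m => edgeB (rep_one n) (Sum.inl m))
    (fun x => Or.inr (Or.inl ⟨x, ?_⟩)) (fun x => ?_) (fun x => ?_)
  · have : ∀ x : PBV n, lamT Sum.inr x = x := by rintro (x | x) <;> rfl
    simp [this]
  · have : ∀ x : PBV n, lamT Sum.inr x = x := by rintro (x | x) <;> rfl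
    simp [this]
  · rcases x with x | x <;> exact Or.inl rfl

theorem one_mul_rep {n : ℕ} {α : Dgm n} {f : PBV n → PBV n} (hα : Rep α f) :
    Rep (pmul (oneD n) α) f := by
  refine mulRep Sum.inl (rep_one n) hα hα.invol (fun m => edgeA (rep_one n) (Sum.inr m))
    (fun x => Or.inr (Or.inr ⟨x, ?_⟩)) (fun x => ?_) (fun x => ?_)
  · have : ∀ x : PBV n, lamB Sum.inl x = x := by rintro (x | x) <;> rfl
    simp [this]
  · rcases x with x | x <;> exact Or.inl rfl
  · have : ∀ x : PBV n, lamB Sum.inl x = x := by rintro (x | x) <;> rfl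
    simp [this]

theorem mul_gen_hook {n : ℕ} {α : Dgm n} {f : PBV n → PBV n} (hα : Rep α f) (k l : Fin n)
    (hkl : f (Sum.inr k) = Sum.inr l) (hne : k ≠ l) : Rep (pmul α (gen k l)) f := by
  have hi := hα.invol
  have hlk : f (Sum.inr l) = Sum.inr k := by rw [← hkl, hi]
  have e : ∀ x : PBV n, lamT Sum.inr x = x := by rintro (x | x) <;> rfl
  have hE : ∀ m, m ≠ k → m ≠ l → RGen (prodEdges α (gen k l)) (Sum.inr (Sum.inl m))
      (topBot (Sum.inr m)) := by
    intro m h1 h2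
    have := edgeB (α := α) (rep_gen k l) (Sum.inl m)
    rwa [genF_inl, if_neg h1, if_neg h2] at this
  have hT : ∀ x, x ≠ Sum.inr k → x ≠ Sum.inr l →
      RGen (prodEdges α (gen k l)) (topMid x) (topBot x) := by
    rintro (m | m) h1 h2
    · exact RGen.refl _
    · exact hE m (by simpa using h1) (by simpa using h2)
  have hK : RGen (prodEdges α (gen k l)) (topBot (Sum.inr k)) (topBot (Sum.inr l)) := by
    have := edgeB (α := α) (rep_gen k l) (Sum.inr k)
    rwa [genF_inr, if_pos rfl] at this
  refine mulRep' Sum.inr hα (rep_gen k l) hi (fun x => ?_) (fun x => ?_) ?_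
  · by_cases h1 : x = Sum.inr k
    · rw [h1, hkl]; exact hK
    by_cases h2 : x = Sum.inr l
    · rw [h2, hlk]; exact hK.symm
    refine (hT x h1 h2).symm.trans ((edgeA hα x).trans (hT _ ?_ ?_))
    · grind
    · grind
  · simp [e]
  · rintro (m | m)
    · simp only [genF_inl]
      split_ifs <;> simp [lamB, *]
    · simp only [genF_inr]
      split_ifs <;> simp [lamB, *]

/-- Conjugation by a transposition. -/
def cj {n : ℕ} (u v : PBV n) (f : PBV n → PBV n) (x : PBV n) : PBV n :=
  Equiv.swap u v (f (Equiv.swap u v x))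

theorem cj_invol {n : ℕ} (u v : PBV n) (f : PBV n → PBV n) (hf : ∀ x, f (f x) = x)
    (x : PBV n) : cj u v f (cj u v f x) = x := by
  simp [cj, hf]

theorem mul_gen_move {n : ℕ} {α : Dgm n} {f : PBV n → PBV n} (hα : Rep α f) (k l : Fin n)
    (h1 : f (Sum.inr k) ≠ Sum.inr k) (h2 : f (Sum.inr k) ≠ Sum.inr l) (hne : k ≠ l) :
    Rep (pmul α (gen k l)) (cj (Sum.inr l) (f (Sum.inr k)) f) := by
  have hi := hα.invol
  have hE : ∀ m, m ≠ k → m ≠ l → RGen (prodEdges α (gen k l)) (Sum.inr (Sum.inl m))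
      (topBot (Sum.inr m)) := by
    intro m h1 h2
    have := edgeB (α := α) (rep_gen k l) (Sum.inl m)
    rwa [genF_inl, if_neg h1, if_neg h2] at this
  have hK : RGen (prodEdges α (gen k l)) (Sum.inr (Sum.inl k)) (topBot (f (Sum.inr k))) := by
    have h := edgeA (β := gen k l) hα (Sum.inr k)
    refine RGen.trans h ?_
    generalize f (Sum.inr k) = P at *
    rcases P with a | m
    · exact RGen.refl _
    · exact hE m (by simpa using h1) (by simpa using h2)
  have hL : RGen (prodEdges α (gen k l)) (Sum.inr (Sum.inl l)) (topBot (f (Sum.inr k))) := by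
    have := edgeB (α := α) (rep_gen k l) (Sum.inl k)
    rw [genF_inl, if_pos rfl] at this
    exact this.symm.trans hK
  refine mulRep (fun m => if m = k ∨ m = l then f (Sum.inr k) else Sum.inr m) hα (rep_gen k l)
    (cj_invol _ _ _ hi) ?_ ?_ ?_ ?_
  · intro m
    by_cases hk : m = k
    · subst hk; simpa using hK
    by_cases hl : m = l
    · subst hl; simpa using hL
    simpa [hk, hl] using hE m hk hl
  · intro x
    have e : ∀ x, lamT (fun m => if m = k ∨ m = l then f (Sum.inr k) else Sum.inr m) x =
      if x = Sum.inr k ∨ x = Sum.inr l then f (Sum.inr k) else x := by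
      rintro (x | x) <;> simp [lamT]
    have h5 : cj (Sum.inr l) (f (Sum.inr k)) f (Sum.inr k) = Sum.inr l := by
      simp only [cj, Equiv.swap_apply_def]; grind
    have h6 : cj (Sum.inr l) (f (Sum.inr k)) f (Sum.inr l) = Sum.inr k := by
      simp only [cj, Equiv.swap_apply_def]; grind
    by_cases hk : x = Sum.inr k
    · subst hk
      exact Or.inr (Or.inr ⟨Sum.inr k, rfl, by rw [h5, genF_inr, if_pos rfl]; rfl⟩)
    by_cases hl : x = Sum.inr l
    · subst hl
      exact Or.inr (Or.inr ⟨Sum.inr l, rfl, by rw [h6, genF_inr, if_neg hne.symm, if_pos rfl]; rfl⟩)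
    refine Or.inr (Or.inl ⟨if x = f (Sum.inr k) then Sum.inr l else x, ?_⟩)
    simp only [e, cj, Equiv.swap_apply_def]
    grind
  · intro x
    have e : ∀ x, lamT (fun m => if m = k ∨ m = l then f (Sum.inr k) else Sum.inr m) x =
      if x = Sum.inr k ∨ x = Sum.inr l then f (Sum.inr k) else x := by
      rintro (x | x) <;> simp [lamT]
    simp only [e, cj, Equiv.swap_apply_def]
    grind
  · have h5 : cj (Sum.inr l) (f (Sum.inr k)) f (Sum.inr k) = Sum.inr l := by
      simp only [cj, Equiv.swap_apply_def]; grind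
    have h6 : cj (Sum.inr l) (f (Sum.inr k)) f (Sum.inr l) = Sum.inr k := by
      simp only [cj, Equiv.swap_apply_def]; grind
    rintro (m | m)
    · simp only [genF_inl]
      split_ifs <;> simp [lamB, *]
    · simp only [genF_inr]
      split_ifs <;> simp [lamB, *]

/-- Cutting the block of `u`. -/
def cut {n : ℕ} (u : PBV n) (f : PBV n → PBV n) (x : PBV n) : PBV n :=
  f (Equiv.swap u (f u) x)

theorem mul_gen_cut {n : ℕ} {α : Dgm n} {f : PBV n → PBV n} (hα : Rep α f) (k : Fin n) :
    Rep (pmul α (gen k k)) (cut (Sum.inr k) f) := by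
  have hi := hα.invol
  have hE : ∀ m, m ≠ k → RGen (prodEdges α (gen k k)) (Sum.inr (Sum.inl m))
      (topBot (Sum.inr m)) := by
    intro m h1 
    have := edgeB (α := α) (rep_gen k k) (Sum.inl m)
    rwa [genF_inl, if_neg h1, if_neg h1] at this
  have hT : ∀ x, x ≠ Sum.inr k →
      RGen (prodEdges α (gen k k)) (topMid x) (topBot x) := by
    rintro (m | m) h1
    · exact RGen.refl _
    · exact hE m (by simpa using h1)
  have e : ∀ x, lamT (fun m => if m = k then f (Sum.inr k) else Sum.inr m) x =
      if x = Sum.inr k then f (Sum.inr k) else x := by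
    rintro (x | x) <;> simp [lamT]
  have hcut : ∀ x, cut (Sum.inr k) f x = if x = Sum.inr k then x else
      if x = f (Sum.inr k) then x else f x := by
    intro x
    simp only [cut, Equiv.swap_apply_def]
    grind
  refine mulRep' (fun m => if m = k then f (Sum.inr k) else Sum.inr m) hα (rep_gen k k)
    ?_ ?_ ?_ ?_
  · intro x
    simp only [hcut]
    grind
  · intro x
    rw [hcut]
    split_ifs with h1 h2
    · exact RGen.refl _
    · exact RGen.refl _
    · exact (hT x h1).symm.trans ((edgeA hα x).trans (hT _ (by grind)))
  · intro x
    simp only [e, hcut]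
    grind
  · rintro (m | m)
    · simp only [genF_inl]
      split_ifs <;> simp [lamB, *]
    · simp only [genF_inr]
      split_ifs <;> simp [lamB, *]

end Dgm

namespace Dgm

/-- The generating set. -/
def Gset (n : ℕ) : Set (Dgm n) := {α | α = oneD n ∨ ∃ k l, α = gen k l}

/-- The diagram of `f` is generated by `Gset n`. -/
def InS {n : ℕ} (f : PBV n → PBV n) : Prop := ∃ α, MClo pmul (Gset n) α ∧ Rep α f

theorem inS_gen {n : ℕ} (k l : Fin n) : InS (genF k l) :=
  ⟨_, MClo.base (Or.inr ⟨k, l, rfl⟩), rep_gen k l⟩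

theorem inS_move {n : ℕ} {f : PBV n → PBV n} (hf : InS f) (k l : Fin n)
    (h1 : f (Sum.inr k) ≠ Sum.inr k) (h2 : f (Sum.inr k) ≠ Sum.inr l) (hne : k ≠ l) :
    InS (cj (Sum.inr l) (f (Sum.inr k)) f) := by
  obtain ⟨α, hα, hr⟩ := hf
  exact ⟨_, MClo.mul hα (MClo.base (Or.inr ⟨k, l, rfl⟩)), mul_gen_move hr k l h1 h2 hne⟩

theorem inS_cut {n : ℕ} {f : PBV n → PBV n} (hf : InS f) (k : Fin n) :
    InS (cut (Sum.inr k) f) := by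
  obtain ⟨α, hα, hr⟩ := hf
  exact ⟨_, MClo.mul hα (MClo.base (Or.inr ⟨k, k, rfl⟩)), mul_gen_cut hr k⟩

theorem cj_self {n : ℕ} (u : PBV n) (f : PBV n → PBV n) : cj u u f = f := by
  funext x; simp [cj]

theorem cj_comm {n : ℕ} (u v : PBV n) (f : PBV n → PBV n) : cj u v f = cj v u f := by
  funext x; simp [cj, Equiv.swap_comm u v]

theorem cj_cj {n : ℕ} (u v : PBV n) (f : PBV n → PBV n) : cj u v (cj u v f) = f := by
  funext x; simp [cj]

theorem inS_invol {n : ℕ} {f : PBV n → PBV n} (hf : InS f) (x : PBV n) : f (f x) = x := by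
  obtain ⟨α, hα, hr⟩ := hf
  exact hr.invol x

theorem relabel1 {n : ℕ} {f : PBV n → PBV n} (hf : InS f) (i j l : Fin n)
    (hij : f (Sum.inr i) = Sum.inr j) (hne : i ≠ j) : InS (cj (Sum.inr i) (Sum.inr l) f) := by
  have hi := inS_invol hf
  have hji : f (Sum.inr j) = Sum.inr i := by rw [← hij, hi]
  by_cases h1 : l = i
  · subst h1; rwa [cj_self]
  by_cases h2 : l = j
  · subst h2
    have : cj (Sum.inr i) (Sum.inr l) f = f := by
      funext x; simp only [cj, Equiv.swap_apply_def]; grind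
    rwa [this]
  have := inS_move hf j l (by rw [hji]; simpa using hne)
    (by rw [hji]; simpa using Ne.symm h1) (Ne.symm h2)
  rwa [hji, cj_comm] at this

theorem swap3 {V : Type*} [DecidableEq V] (i k l : V) (h1 : i ≠ k) (h2 : i ≠ l) (h3 : k ≠ l)
    (y : V) :
    Equiv.swap l i (Equiv.swap k l (Equiv.swap i k y)) = Equiv.swap k l y := by
  simp only [Equiv.swap_apply_def]; grind

theorem swap3' {V : Type*} [DecidableEq V] (i k l : V) (h1 : i ≠ k) (h2 : i ≠ l) (h3 : k ≠ l)
    (y : V) :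
    Equiv.swap i k (Equiv.swap k l (Equiv.swap l i y)) = Equiv.swap k l y := by
  simp only [Equiv.swap_apply_def]; grind

theorem relabel2 {n : ℕ} {f : PBV n → PBV n} (hf : InS f) (i j k l : Fin n)
    (hij : f (Sum.inr i) = Sum.inr j) (hne : i ≠ j) : InS (cj (Sum.inr k) (Sum.inr l) f) := by
  have hi := inS_invol hf
  have hji : f (Sum.inr j) = Sum.inr i := by rw [← hij, hi]
  by_cases h0 : k = l
  · subst h0; rwa [cj_self]
  by_cases h1 : k = i
  · subst h1; exact relabel1 hf k j l hij hne
  by_cases h2 : k = j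
  · subst h2; exact relabel1 hf k i l hji hne.symm
  by_cases h3 : l = i
  · subst h3; rw [cj_comm]; exact relabel1 hf l j k hij hne
  by_cases h4 : l = j
  · subst h4; rw [cj_comm]; exact relabel1 hf l i k hji hne.symm
  have f1 := relabel1 hf i j k hij hne
  have e1 : cj (Sum.inr i) (Sum.inr k) f (Sum.inr k) = Sum.inr j := by
    simp only [cj, Equiv.swap_apply_def]; grind
  have f2 := relabel1 f1 k j l e1 h2
  have e2 : cj (Sum.inr k) (Sum.inr l) (cj (Sum.inr i) (Sum.inr k) f) (Sum.inr l)
      = Sum.inr j := by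
    rw [cj, Equiv.swap_apply_right, e1, Equiv.swap_apply_of_ne_of_ne] <;> grind
  have f3 := relabel1 f2 l j i e2 h4
  convert f3 using 1
  funext x
  simp only [cj]
  rw [swap3 (Sum.inr i : PBV n) (Sum.inr k) (Sum.inr l) (by grind) (by grind) (by grind),
    swap3' (Sum.inr i : PBV n) (Sum.inr k) (Sum.inr l) (by grind) (by grind) (by grind)]

/-- Relabelling of the lower row. -/
def rel {n : ℕ} (σ : Equiv.Perm (Fin n)) (f : PBV n → PBV n) (x : PBV n) : PBV n :=
  Sum.map id σ (f (Sum.map id σ.symm x))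

theorem rel_hook {n : ℕ} (σ : Equiv.Perm (Fin n)) {f : PBV n → PBV n}
    (h : ∃ i j, f (Sum.inr i) = Sum.inr j ∧ i ≠ j) :
    ∃ i j, rel σ f (Sum.inr i) = Sum.inr j ∧ i ≠ j := by
  obtain ⟨i, j, hij, hne⟩ := h
  exact ⟨σ i, σ j, by simp [rel, hij], by simpa using hne⟩

theorem inS_rel {n : ℕ} (σ : Equiv.Perm (Fin n)) {f : PBV n → PBV n} (hf : InS f)
    (h : ∃ i j, f (Sum.inr i) = Sum.inr j ∧ i ≠ j) : InS (rel σ f) := by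
  induction σ using Equiv.Perm.swap_induction_on with
  | one =>
    have : rel 1 f = f := by
      funext x
      have : ∀ y : PBV n, Sum.map id (1 : Equiv.Perm (Fin n)) y = y := by
        rintro (y | y) <;> rfl
      have h2 : ∀ y : PBV n, Sum.map id (1 : Equiv.Perm (Fin n)).symm y = y := by
        rintro (y | y) <;> rfl
      simp only [rel, this, h2]
    rwa [this]
  | swap_mul σ x y hxy ih =>
    obtain ⟨i, j, hij, hne⟩ := rel_hook σ h
    have := relabel2 ih i j x y hij hne
    convert this using 1
    have e : ∀ z : PBV n, Equiv.swap (Sum.inr x) (Sum.inr y) z =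
        Sum.map id (Equiv.swap x y) z := by
      rintro (z | z)
      · simp [Equiv.swap_apply_def]
      · simp only [Equiv.swap_apply_def, Sum.map_inr, Sum.inr.injEq]
        split_ifs <;> rfl
    have e2 : (Equiv.swap x y * σ).symm = σ.symm * Equiv.swap x y := by
      have : (Equiv.swap x y * σ).symm = σ.symm * (Equiv.swap x y).symm := rfl
      rw [this, Equiv.symm_swap]
    funext z
    simp only [rel, cj, e, e2]
    rcases z with z | z <;> simp [Function.comp_def]

/-- Upper points outside of transversals. -/
def NU {n : ℕ} (f : PBV n → PBV n) : Finset (Fin n) :=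
  Finset.univ.filter fun a => ∃ b, f (Sum.inl a) = Sum.inl b

/-- Lower points outside of transversals. -/
def NL {n : ℕ} (f : PBV n → PBV n) : Finset (Fin n) :=
  Finset.univ.filter fun a => ∃ b, f (Sum.inr a) = Sum.inr b

theorem card_NU_eq {n : ℕ} (f : PBV n → PBV n) (hf : ∀ x, f (f x) = x) :
    (NU f).card = (NL f).card := by
  have h : ((NU f)ᶜ).card = ((NL f)ᶜ).card := by
    refine Finset.card_bij' (fun a _ => Sum.elim id id (f (Sum.inl a)))
      (fun a _ => Sum.elim id id (f (Sum.inr a))) ?_ ?_ ?_ ?_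
    · intro a ha
      simp only [NU, Finset.mem_compl, Finset.mem_filter, Finset.mem_univ, true_and] at ha
      rcases hb : f (Sum.inl a) with b | b
      · exact absurd ⟨b, hb⟩ ha
      · have := hf (Sum.inl a)
        rw [hb] at this
        simp [NL, this]
    · intro a ha
      simp only [NL, Finset.mem_compl, Finset.mem_filter, Finset.mem_univ, true_and] at ha
      rcases hb : f (Sum.inr a) with b | b
      · have := hf (Sum.inr a)
        rw [hb] at this
        simp [NU, this]
      · exact absurd ⟨b, hb⟩ ha
    · intro a ha
      simp only [NU, Finset.mem_compl, Finset.mem_filter, Finset.mem_univ, true_and] at ha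
      rcases hb : f (Sum.inl a) with b | b
      · exact absurd ⟨b, hb⟩ ha
      · have := hf (Sum.inl a)
        rw [hb] at this
        simp [this]
    · intro a ha
      simp only [NL, Finset.mem_compl, Finset.mem_filter, Finset.mem_univ, true_and] at ha
      rcases hb : f (Sum.inr a) with b | b
      · have := hf (Sum.inr a)
        rw [hb] at this
        simp [this]
      · exact absurd ⟨b, hb⟩ ha
  rw [Finset.card_compl, Finset.card_compl] at h
  have h1 := Finset.card_le_univ (NU f)
  have h2 := Finset.card_le_univ (NL f)
  omega

theorem base_case {n : ℕ} (f : PBV n → PBV n) (hf : ∀ x, f (f x) = x)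
    (h2 : (NU f).card = 2) (i j : Fin n) (hij : f (Sum.inr i) = Sum.inr j) (hne : i ≠ j) :
    InS f := by
  have hji : f (Sum.inr j) = Sum.inr i := by rw [← hij, hf]
  obtain ⟨p, q, hpq, hN⟩ := Finset.card_eq_two.1 h2
  have hN' : ∀ a, (∃ b, f (Sum.inl a) = Sum.inl b) ↔ (a = p ∨ a = q) := by
    intro a
    have : a ∈ NU f ↔ a ∈ ({p, q} : Finset (Fin n)) := by rw [hN]
    simpa [NU] using this
  have hT : ∀ a, a ≠ p → a ≠ q → ∃ b, f (Sum.inl a) = Sum.inr b := by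
    intro a h1 h2
    rcases hb : f (Sum.inl a) with b | b
    · have := (hN' a).1 ⟨b, hb⟩
      tauto
    · exact ⟨b, rfl⟩
  obtain ⟨p', hp'⟩ := (hN' p).2 (Or.inl rfl)
  obtain ⟨q', hq'⟩ := (hN' q).2 (Or.inr rfl)
  have hp'' : p' = p ∨ p' = q := (hN' p').1 ⟨p, by rw [← hp', hf]⟩
  have hq'' : q' = p ∨ q' = q := (hN' q').1 ⟨q, by rw [← hq', hf]⟩
  let s : Fin n → Fin n := fun b => if b = p then i else if b = q then j else
    Sum.elim id id (f (Sum.inl b))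
  have sp : s p = i := by simp [s]
  have sq : s q = j := by simp [s, hpq.symm]
  have sT : ∀ a, a ≠ p → a ≠ q → f (Sum.inl a) = Sum.inr (s a) := by
    intro a h1 h2
    obtain ⟨b, hb⟩ := hT a h1 h2
    simp [s, h1, h2, hb]
  have sT' : ∀ a, a ≠ p → a ≠ q → f (Sum.inr (s a)) = Sum.inl a := by
    intro a h1 h2
    rw [← sT a h1 h2, hf]
  clear_value s
  have sinj : Function.Injective s := by
    intro a b hab
    by_contra hc
    have := sT' a
    have := sT' b
    grind
  let e : Equiv.Perm (Fin n) := Equiv.ofBijective s (Finite.injective_iff_bijective.1 sinj)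
  have he : ∀ a, e a = s a := fun a => rfl
  clear_value e
  have fin : ∀ t : PBV n → PBV n, InS t → (∃ i j, t (Sum.inr i) = Sum.inr j ∧ i ≠ j) →
      (∀ y, f (Sum.map id e y) = Sum.map id e (t y)) → InS f := by
    intro t ht hk hy
    have h3 := inS_rel e ht hk
    have : rel e t = f := by
      funext x
      rw [rel, ← hy]
      congr 1
      rcases x with x | x <;> simp
    rwa [this] at h3
  rcases hp'' with rfl | rfl
  · have hq3 : q' = q := by grind
    subst hq3
    have h5 := inS_move (inS_gen p' p') q' p' (by simp [genF_inr, hpq.symm])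
      (by simp [genF_inr, hpq.symm]) hpq.symm
    have e1 : ∀ x, cj (Sum.inr p') (genF p' p' (Sum.inr q')) (genF p' p') x =
        match x with
        | Sum.inl m => if m = p' ∨ m = q' then Sum.inl m else Sum.inr m
        | Sum.inr m => if m = p' then Sum.inr q' else if m = q' then Sum.inr p' else Sum.inl m := by
      rintro (m | m)
      · simp only [cj, genF_inr, Equiv.swap_apply_def]
        grind [genF_inl, genF_inr]
      · simp only [cj, genF_inr, Equiv.swap_apply_def]
        grind [genF_inl, genF_inr]
    refine fin _ h5 ⟨p', q', by simp [e1], hpq⟩ ?_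
    rintro (m | m)
    · rw [e1]
      by_cases h1 : m = p'
      · subst h1; simp [hp']
      by_cases h2 : m = q'
      · subst h2; simp [hq']
      simp [h1, h2, sT m h1 h2, he]
    · rw [e1]
      by_cases h1 : m = p'
      · subst h1; simp [he, sp, sq, hij]
      by_cases h2 : m = q'
      · subst h2; simp [he, sp, sq, hji, h1]
      simp [h1, h2, sT' m h1 h2, he]
  · have hq3 : q' = p := by grind
    subst hq3
    refine fin _ (inS_gen q' p') ⟨q', p', by simp [genF_inr], hpq⟩ ?_
    rintro (m | m)
    · rw [genF_inl]
      by_cases h1 : m = q'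
      · subst h1; simp [hp']
      by_cases h2 : m = p'
      · subst h2; simp [hq', h1]
      simp [h1, h2, sT m h1 h2, he]
    · rw [genF_inr]
      by_cases h1 : m = q'
      · subst h1; simp [he, sp, sq, hij]
      by_cases h2 : m = p'
      · subst h2; simp [he, sp, sq, hji, h1]
      simp [h1, h2, sT' m h1 h2, he]

theorem main_gen {n : ℕ} : ∀ (m : ℕ), 2 ≤ m → ∀ (f : PBV n → PBV n), (∀ x, f (f x) = x) →
    (NU f).card = m → InS f := by
  intro m
  induction m using Nat.strong_induction_on with
  | _ m ih =>
  intro hm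
  have A : ∀ (f : PBV n → PBV n), (∀ x, f (f x) = x) → (NU f).card = m →
      ∀ i j : Fin n, f (Sum.inr i) = Sum.inr j → i ≠ j → InS f := by
    intro f hf hN i j hij hne
    have hji : f (Sum.inr j) = Sum.inr i := by rw [← hij, hf]
    rcases Nat.lt_or_ge 2 m with h3 | h3
    swap
    · exact base_case f hf (by omega) i j hij hne
    have fin : ∀ p b, f (Sum.inl p) = Sum.inl b →
        InS (cj (Sum.inr j) (Sum.inl p) f) → InS f := by
      intro p b hp hS
      have e1 : cj (Sum.inr j) (Sum.inl p) f (Sum.inr i) = Sum.inl p := by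
        simp only [cj, Equiv.swap_apply_def]; grind
      have := inS_move hS i j (by rw [e1]; simp) (by rw [e1]; simp) hne
      rwa [e1, cj_cj] at this
    by_cases hs : ∃ p, f (Sum.inl p) = Sum.inl p
    · obtain ⟨p, hp⟩ := hs
      refine fin p p hp (ih (m - 1) (by omega) (by omega) _ (cj_invol _ _ _ hf) ?_)
      have : NU (cj (Sum.inr j) (Sum.inl p) f) = (NU f).erase p := by
        ext a
        simp only [NU, Finset.mem_filter, Finset.mem_univ, true_and, Finset.mem_erase, cj,
          Equiv.swap_apply_def]
        grind
      rw [this, Finset.card_erase_of_mem (by simp [NU, hp]), hN]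
    · push Not at hs
      have hpos : (NU f).Nonempty := by rw [← Finset.card_pos]; omega
      obtain ⟨p, hp⟩ := hpos
      obtain ⟨q, hq⟩ : ∃ b, f (Sum.inl p) = Sum.inl b := by simpa [NU] using hp
      have hqp : f (Sum.inl q) = Sum.inl p := by rw [← hq, hf]
      have hpq : p ≠ q := by rintro rfl; exact hs _ hq
      have hqN : q ∈ (NU f).erase p := by simp [NU, hqp, hpq.symm]
      have hc : (((NU f).erase p).erase q).card = m - 2 := by
        rw [Finset.card_erase_of_mem hqN, Finset.card_erase_of_mem hp, hN]; omega
      have h4 : 4 ≤ m := by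
        by_contra hlt
        obtain ⟨u, hu⟩ := Finset.card_eq_one.1 (hc.trans (by omega : m - 2 = 1))
        have hu1 : u ∈ ((NU f).erase p).erase q := by simp [hu]
        have hu2 : ∀ v, v ∈ ((NU f).erase p).erase q → v = u := by simp [hu]
        simp only [NU, Finset.mem_filter, Finset.mem_univ, true_and, Finset.mem_erase] at hu1 hu2
        obtain ⟨hu3, hu4, w, hw⟩ := hu1
        have hw' : f (Sum.inl w) = Sum.inl u := by rw [← hw, hf]
        have h5 := hu2 w ⟨?_, ?_, u, hw'⟩
        · subst h5; exact hs _ hw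
        · rintro rfl; rw [hqp] at hw'; exact hu4 (Sum.inl.inj hw').symm
        · rintro rfl; rw [hq] at hw'; exact hu3 (Sum.inl.inj hw').symm
      refine fin p q hq (ih (m - 2) (by omega) (by omega) _ (cj_invol _ _ _ hf) ?_)
      rw [← hc]
      congr 1
      ext a
      simp only [NU, Finset.mem_filter, Finset.mem_univ, true_and, Finset.mem_erase, cj,
        Equiv.swap_apply_def]
      grind
  intro f hf hN
  by_cases hh : ∃ i j : Fin n, f (Sum.inr i) = Sum.inr j ∧ i ≠ j
  · obtain ⟨i, j, h1, h2⟩ := hh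
    exact A f hf hN i j h1 h2
  push Not at hh
  have hL : 1 < (NL f).card := by rw [← card_NU_eq f hf]; omega
  obtain ⟨i, hi, j, hj, hij⟩ := Finset.one_lt_card.1 hL
  simp only [NL, Finset.mem_filter, Finset.mem_univ, true_and] at hi hj
  obtain ⟨i', hi⟩ := hi
  obtain ⟨j', hj⟩ := hj
  obtain rfl := hh _ _ hi
  obtain rfl := hh _ _ hj
  have hS := A (fun x => f (Equiv.swap (Sum.inr i) (Sum.inr j) x)) ?_ ?_ i j (by simp [hj]) hij
  · have := inS_cut hS i
    convert this using 1
    funext x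
    simp [cut, hj]
  · intro x
    simp only [Equiv.swap_apply_def]
    grind
  · rw [← hN]
    congr 1

theorem dom_rep {n : ℕ} {α : Dgm n} {f : PBV n → PBV n} (h : Rep α f) :
    domSet α = {a | ∃ b, f (Sum.inl a) = Sum.inr b} := by
  ext a
  simp only [domSet, Set.mem_ofPred_eq]
  refine exists_congr fun b => ?_
  rw [h]
  simp [eq_comm]

theorem prank_rep {n : ℕ} {α : Dgm n} {f : PBV n → PBV n} (h : Rep α f) :
    prank α + (NU f).card = n := by
  have : domSet α = (((NU f)ᶜ : Finset (Fin n)) : Set (Fin n)) := by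
    rw [dom_rep h]
    ext a
    simp only [Set.mem_ofPred_eq, Finset.coe_compl, Set.mem_compl_iff, Finset.mem_coe, NU,
      Finset.mem_filter, Finset.mem_univ, true_and]
    rcases f (Sum.inl a) with b | b <;> simp
  rw [prank, this, Set.ncard_coe_finset, Finset.card_compl]
  have := Finset.card_le_univ (NU f)
  simp at *
  omega

theorem ideal_gen {n : ℕ} (hn : 2 ≤ n) {α : Dgm n} (h : α ∈ IPB n (n - 2)) :
    MClo pmul (Gset n) α := by
  obtain ⟨f, hf⟩ := IsPB.exists_rep h.1
  have h1 := prank_rep hf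
  have h2 := h.2
  obtain ⟨β, hβ, hr⟩ := main_gen (NU f).card (by omega) f hf.invol rfl
  rwa [hf.ext hr]

end Dgm

namespace Dgm

/-- `{a, b}` is an upper block. -/
def UB {n : ℕ} (α : Dgm n) (a b : Fin n) : Prop :=
  ∀ y, α.r (Sum.inl a) y ↔ (y = Sum.inl a ∨ y = Sum.inl b)

/-- `{a', b'}` is a lower block. -/
def LB {n : ℕ} (α : Dgm n) (a b : Fin n) : Prop :=
  ∀ y, α.r (Sum.inr a) y ↔ (y = Sum.inr a ∨ y = Sum.inr b)

theorem UB.mul {n : ℕ} {α : Dgm n} (β : Dgm n) {a b : Fin n} (h : UB α a b) :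
    UB (pmul α β) a b := by
  intro y
  constructor
  · intro hy
    have hq : ∀ x : PBV n, (topMid x = Sum.inl a ∨ topMid x = Sum.inl b) ↔
        α.r (Sum.inl a) x := by
      intro x
      rw [h x]
      rcases x with x | x <;> simp [topMid]
    have := (RGen.inv (fun v : V3 n => v = Sum.inl a ∨ v = Sum.inl b) ?_ hy).1 (Or.inl rfl)
    · rcases y with y | y <;> simpa [topBot] using this
    · rintro u v (⟨x, z, hxz, rfl, rfl⟩ | ⟨x, z, hxz, rfl, rfl⟩)
      · rw [hq, hq]
        exact ⟨fun h => α.iseqv.trans h hxz, fun h => α.iseqv.trans h (α.iseqv.symm hxz)⟩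
      · rcases x with x | x <;> rcases z with z | z <;> simp [midBot]
  · rintro (rfl | rfl)
    · exact RGen.refl _
    · exact RGen.rel (Or.inl ⟨Sum.inl a, Sum.inl b, (h _).2 (Or.inr rfl), rfl, rfl⟩)

theorem LB.mul {n : ℕ} {β : Dgm n} (α : Dgm n) {a b : Fin n} (h : LB β a b) :
    LB (pmul α β) a b := by
  intro y
  constructor
  · intro hy
    have hq : ∀ x : PBV n, (midBot x = Sum.inr (Sum.inr a) ∨ midBot x = Sum.inr (Sum.inr b)) ↔
        β.r (Sum.inr a) x := by
      intro x
      rw [h x]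
      rcases x with x | x <;> simp [midBot]
    have := (RGen.inv (fun v : V3 n => v = Sum.inr (Sum.inr a) ∨ v = Sum.inr (Sum.inr b))
      ?_ hy).1 (Or.inl rfl)
    · rcases y with y | y <;> simpa [topBot] using this
    · rintro u v (⟨x, z, hxz, rfl, rfl⟩ | ⟨x, z, hxz, rfl, rfl⟩)
      · rcases x with x | x <;> rcases z with z | z <;> simp [topMid]
      · rw [hq, hq]
        exact ⟨fun h => β.iseqv.trans h hxz, fun h => β.iseqv.trans h (β.iseqv.symm hxz)⟩
  · rintro (rfl | rfl)
    · exact RGen.refl _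
    · exact RGen.rel (Or.inr ⟨Sum.inr a, Sum.inr b, (h _).2 (Or.inr rfl), rfl, rfl⟩)

theorem Rep.ub {n : ℕ} {α : Dgm n} {f : PBV n → PBV n} (h : Rep α f) (a b : Fin n) :
    UB α a b ↔ f (Sum.inl a) = Sum.inl b := by
  constructor
  · intro hu
    have h1 := (hu _).1 ((h _ _).2 (Or.inr rfl))
    have h2 := (h _ _).1 ((hu _).2 (Or.inr rfl))
    rcases h2 with h2 | h2
    · rcases h1 with h1 | h1
      · rw [h1, h2]
      · exact h1
    · exact h2.symm
  · intro hf y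
    rw [h, hf]

theorem Rep.lb {n : ℕ} {α : Dgm n} {f : PBV n → PBV n} (h : Rep α f) (a b : Fin n) :
    LB α a b ↔ f (Sum.inr a) = Sum.inr b := by
  constructor
  · intro hu
    have h1 := (hu _).1 ((h _ _).2 (Or.inr rfl))
    have h2 := (h _ _).1 ((hu _).2 (Or.inr rfl))
    rcases h2 with h2 | h2
    · rcases h1 with h1 | h1
      · rw [h1, h2]
      · exact h1
    · exact h2.symm
  · intro hf y
    rw [h, hf]

theorem prank_mul_left {n : ℕ} {α β : Dgm n} (hα : IsPB α) (hβ : IsPB β) :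
    prank (pmul α β) ≤ prank α := by
  obtain ⟨f, hf⟩ := hα.exists_rep
  obtain ⟨g, hg⟩ := (isPB_pmul hα hβ).exists_rep
  have : NU f ⊆ NU g := by
    intro a ha
    simp only [NU, Finset.mem_filter, Finset.mem_univ, true_and] at ha ⊢
    obtain ⟨b, hb⟩ := ha
    exact ⟨b, (hg.ub a b).1 (((hf.ub a b).2 hb).mul β)⟩
  have := Finset.card_le_card this
  have h1 := prank_rep hf
  have h2 := prank_rep hg
  omega

theorem prank_mul_right {n : ℕ} {α β : Dgm n} (hα : IsPB α) (hβ : IsPB β) :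
    prank (pmul α β) ≤ prank β := by
  obtain ⟨f, hf⟩ := hβ.exists_rep
  obtain ⟨g, hg⟩ := (isPB_pmul hα hβ).exists_rep
  have : NL f ⊆ NL g := by
    intro a ha
    simp only [NL, Finset.mem_filter, Finset.mem_univ, true_and] at ha ⊢
    obtain ⟨b, hb⟩ := ha
    exact ⟨b, (hg.lb a b).1 (((hf.lb a b).2 hb).mul α)⟩
  have := Finset.card_le_card this
  have h1 := prank_rep hf
  have h2 := prank_rep hg
  have h3 := card_NU_eq f hf.invol
  have h4 := card_NU_eq g hg.invol
  omega

theorem idpt_dom {n : ℕ} {α : Dgm n} {f : PBV n → PBV n} (hf : Rep α f) (hid : IsIdpt α)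
    (i : Fin n) (hi : ∀ a, a ≠ i → ∃ b, f (Sum.inl a) = Sum.inr b) (a b : Fin n)
    (hab : f (Sum.inl a) = Sum.inr b) : b = a := by
  have hinv := hf.invol
  have hr : α.r (Sum.inl a) (Sum.inr b) := (hf _ _).2 (Or.inr hab.symm)
  rcases hc : f (Sum.inl b) with c | c
  · exfalso
    have hbi : b = i := by
      by_contra hne
      obtain ⟨d, hd⟩ := hi b hne
      rw [hc] at hd
      exact absurd hd (by simp)
    have hci : c = i := by
      by_contra hne
      obtain ⟨d, hd⟩ := hi c hne
      rw [← hc, hinv] at hd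
      exact absurd hd (by simp)
    subst hbi
    subst hci
    have hr' : (pmul α α).r (Sum.inl a) (Sum.inr c) := by rw [hid]; exact hr
    have := (RGen.inv (fun v : V3 n => v = Sum.inl a ∨ v = Sum.inr (Sum.inl c)) ?_ hr').1
      (Or.inl rfl)
    · simp [topBot] at this
    · have hba : f (Sum.inr c) = Sum.inl a := by rw [← hab, hinv]
      rintro u v (⟨x, z, hxz, rfl, rfl⟩ | ⟨x, z, hxz, rfl, rfl⟩)
      · have hq : ∀ x : PBV n, (topMid x = Sum.inl a ∨ topMid x = Sum.inr (Sum.inl c)) ↔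
            (x = Sum.inl a ∨ x = Sum.inr c) := by
          rintro (x | x) <;> simp [topMid]
        rw [hq, hq]
        have := hinv x
        rcases (hf _ _).1 hxz with h | h <;> subst h
        · rfl
        · grind
      · have hq : ∀ x : PBV n, (midBot x = Sum.inl a ∨ midBot x = Sum.inr (Sum.inl c)) ↔
            (x = Sum.inl c) := by
          rintro (x | x) <;> simp [midBot]
        rw [hq, hq]
        have := hinv x
        rcases (hf _ _).1 hxz with h | h <;> subst h
        · rfl
        · grind
  · have h1 : (pmul α α).r (Sum.inl a) (Sum.inr c) := by
      have h2 := edgeA (β := α) hf (Sum.inl a)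
      have h3 := edgeB (α := α) hf (Sum.inl b)
      rw [hab] at h2
      rw [hc] at h3
      exact RGen.trans h2 h3
    rw [hid, hf, hab] at h1
    have hcb : c = b := by simpa using h1
    subst hcb
    have := hinv (Sum.inl c)
    rw [hc, ← hab, hinv] at this
    exact (Sum.inl.inj this).symm

/-- The target set. -/
def Tset (n : ℕ) : Set (Dgm n) :=
  {α | α ∈ DPB n n ∪ DPB n (n - 1) ∧ IsIdpt α} ∪ IPB n (n - 2)

theorem T_pb {n : ℕ} {α : Dgm n} (h : α ∈ Tset n) : IsPB α := by
  rcases h with ⟨h | h, _⟩ | h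
  · exact h.1
  · exact h.1
  · exact h.1

theorem idpt_T {n : ℕ} {α : Dgm n} (h : IsPB α) (hi : IsIdpt α) : α ∈ Tset n := by
  obtain ⟨f, hf⟩ := h.exists_rep
  have h1 := prank_rep hf
  by_cases h2 : prank α = n
  · exact Or.inl ⟨Or.inl ⟨h, h2⟩, hi⟩
  by_cases h3 : prank α = n - 1
  · exact Or.inl ⟨Or.inr ⟨h, h3⟩, hi⟩
  · exact Or.inr ⟨h, by omega⟩

theorem idpt_one (n : ℕ) : IsIdpt (oneD n) := (mul_one_rep (rep_one n)).ext (rep_one n)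

theorem idpt_gen {n : ℕ} (k l : Fin n) : IsIdpt (gen k l) := by
  by_cases h : k = l
  · subst h
    refine (mul_gen_cut (rep_gen k k) k).ext ?_
    have : cut (Sum.inr k) (genF k k) = genF k k := by
      funext x; simp [cut, genF_inr]
    rw [this]
    exact rep_gen k k
  · exact (mul_gen_hook (rep_gen k l) k l (by simp [genF_inr]) h).ext (rep_gen k l)

theorem T_full {n : ℕ} (hn : 2 ≤ n) {α : Dgm n} (h : α ∈ Tset n)
    (hN : ∀ a b, ¬ UB α a b) : α = oneD n := by
  obtain ⟨f, hf⟩ := (T_pb h).exists_rep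
  have h1 := prank_rep hf
  have h0 : NU f = ∅ := by
    ext a
    simp only [NU, Finset.mem_filter, Finset.mem_univ, true_and, Finset.notMem_empty, iff_false]
    rintro ⟨b, hb⟩
    exact hN a b ((hf.ub a b).2 hb)
  rw [h0, Finset.card_empty] at h1
  have hid : IsIdpt α := by
    rcases h with ⟨_, h⟩ | h
    · exact h
    · have := h.2
      omega
  have hT : ∀ a, ∃ b, f (Sum.inl a) = Sum.inr b := by
    intro a
    rcases hb : f (Sum.inl a) with b | b
    · exact absurd ((hf.ub a b).2 hb) (hN a b)
    · exact ⟨b, rfl⟩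
  have hT' : ∀ a, f (Sum.inl a) = Sum.inr a := by
    intro a
    obtain ⟨b, hb⟩ := hT a
    rw [hb, idpt_dom hf hid ⟨0, by omega⟩ (fun a _ => hT a) a b hb]
  have : f = swapUD := by
    funext x
    rcases x with x | x
    · exact hT' x
    · have h5 : f (Sum.inr x) = Sum.inl x := by rw [← hT' x, hf.invol]
      exact h5
  subst this
  exact hf.ext (rep_one n)

theorem T_cases {n : ℕ} (hn : 2 ≤ n) {α : Dgm n} (h : α ∈ Tset n) :
    α = oneD n ∨ (∃ i, α = gen i i) ∨ α ∈ IPB n (n - 2) := by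
  obtain ⟨f, hf⟩ := (T_pb h).exists_rep
  have h1 := prank_rep hf
  have hT := h
  rcases h with ⟨h | h, hid⟩ | h
  · left
    refine T_full hn hT ?_
    intro a b hab
    have : a ∈ NU f := by simp [NU, (hf.ub a b).1 hab]
    have := Finset.card_pos.2 ⟨a, this⟩
    have := h.2
    omega
  · right; left
    have h2 := h.2
    obtain ⟨i, hi⟩ := Finset.card_eq_one.1 (by omega : (NU f).card = 1)
    have hi' : ∀ a, (∃ b, f (Sum.inl a) = Sum.inl b) ↔ a = i := by
      intro a
      have : a ∈ NU f ↔ a ∈ ({i} : Finset (Fin n)) := by rw [hi]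
      simpa [NU] using this
    have hd : ∀ a, a ≠ i → ∃ b, f (Sum.inl a) = Sum.inr b := by
      intro a ha
      rcases hb : f (Sum.inl a) with b | b
      · exact absurd ((hi' a).1 ⟨b, hb⟩) ha
      · exact ⟨b, rfl⟩
    have hd' : ∀ a, a ≠ i → f (Sum.inl a) = Sum.inr a := by
      intro a ha
      obtain ⟨b, hb⟩ := hd a ha
      rw [hb, idpt_dom hf hid i hd a b hb]
    have hinv := hf.invol
    have hii : f (Sum.inl i) = Sum.inl i := by
      obtain ⟨b, hb⟩ := (hi' i).2 rfl
      have : b = i := (hi' b).1 ⟨i, by rw [← hb, hinv]⟩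
      rw [hb, this]
    have hd'' : ∀ a, a ≠ i → f (Sum.inr a) = Sum.inl a := by
      intro a ha
      rw [← hd' a ha, hinv]
    have hjj : f (Sum.inr i) = Sum.inr i := by
      have h3 := hinv (Sum.inr i)
      rcases hb : f (Sum.inr i) with b | b
      · rw [hb] at h3
        by_cases hbi : b = i
        · subst hbi; rw [hii] at h3; exact absurd h3 (by simp)
        · rw [hd' b hbi] at h3; exact absurd (Sum.inr.inj h3) hbi
      · rw [hb] at h3
        by_cases hbi : b = i
        · rw [hbi]
        · rw [hd'' b hbi] at h3; exact absurd h3 (by simp)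
    refine ⟨i, ?_⟩
    have : f = genF i i := by
      funext x
      rcases x with x | x
      · rw [genF_inl]; split_ifs with h
        · rw [h, hii]
        · exact hd' x h
      · rw [genF_inr]; split_ifs with h
        · rw [h, hjj]
        · exact hd'' x h
    subst this
    exact hf.ext (rep_gen i i)
  · exact Or.inr (Or.inr h)

theorem T_mul {n : ℕ} (hn : 2 ≤ n) {α β : Dgm n} (hα : α ∈ Tset n) (hβ : β ∈ Tset n) :
    pmul α β ∈ Tset n := by
  have pα := T_pb hα
  have pβ := T_pb hβ
  have pp := isPB_pmul pα pβ
  rcases T_cases hn hα with h | ⟨i, h⟩ | h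
  · obtain ⟨f, hf⟩ := pβ.exists_rep
    rw [h, (one_mul_rep hf).ext hf]
    exact hβ
  · rcases T_cases hn hβ with h' | ⟨j, h'⟩ | h'
    · obtain ⟨f, hf⟩ := pα.exists_rep
      rw [h', (mul_one_rep hf).ext hf]
      exact hα
    · by_cases hij : i = j
      · subst hij
        rw [h, h', idpt_gen i i, ← h]
        exact hα
      · right
        refine ⟨pp, ?_⟩
        have hr : Rep (pmul α β) (cut (Sum.inr j) (genF i i)) := by
          rw [h, h']; exact mul_gen_cut (rep_gen i i) j
        have h1 := prank_rep hr
        have hsub : ({i, j} : Finset (Fin n)) ⊆ NU (cut (Sum.inr j) (genF i i)) := by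
          have hji : j ≠ i := Ne.symm hij
          intro a ha
          simp only [Finset.mem_insert, Finset.mem_singleton] at ha
          simp only [NU, Finset.mem_filter, Finset.mem_univ, true_and]
          rcases ha with rfl | rfl
          · exact ⟨a, by simp [cut, genF_inr, genF_inl, hji, Equiv.swap_apply_def, hij]⟩
          · exact ⟨a, by simp [cut, genF_inr, hji]⟩
        have := Finset.card_le_card hsub
        rw [Finset.card_pair hij] at this
        omega
    · exact Or.inr ⟨pp, (prank_mul_right pα pβ).trans h'.2⟩
  · exact Or.inr ⟨pp, (prank_mul_left pα pβ).trans h.2⟩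

theorem MClo.sub {γ : Type*} {m : γ → γ → γ} {X T : Set γ} (h : X ⊆ T)
    (hT : ∀ x y, x ∈ T → y ∈ T → m x y ∈ T) {x : γ} (hx : MClo m X x) : x ∈ T := by
  induction hx with
  | base h' => exact h h'
  | mul _ _ h1 h2 => exact hT _ _ h1 h2

theorem gen_G {n : ℕ} (hn : 2 ≤ n) : genSet (pmul (n := n)) (Gset n) = Tset n := by
  apply Set.Subset.antisymm
  · intro x hx
    refine MClo.sub ?_ (fun x y => T_mul hn) hx
    rintro x (rfl | ⟨k, l, rfl⟩)
    · exact idpt_T (rep_one n).isPB (idpt_one n)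
    · exact idpt_T (rep_gen k l).isPB (idpt_gen k l)
  · intro x hx
    rcases T_cases hn hx with rfl | ⟨i, rfl⟩ | h
    · exact MClo.base (Or.inl rfl)
    · exact MClo.base (Or.inr ⟨i, i, rfl⟩)
    · exact ideal_gen hn h

theorem gen_E {n : ℕ} (hn : 2 ≤ n) :
    genSet (pmul (n := n)) {α | α ∈ PBset n ∧ IsIdpt α} = Tset n := by
  apply Set.Subset.antisymm
  · intro x hx
    refine MClo.sub ?_ (fun x y => T_mul hn) hx
    rintro x ⟨h1, h2⟩
    exact idpt_T h1 h2
  · rw [← gen_G hn]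
    intro x hx
    refine MClo.sub ?_ (fun x y => MClo.mul) hx
    rintro x (rfl | ⟨k, l, rfl⟩)
    · exact MClo.base ⟨(rep_one n).isPB, idpt_one n⟩
    · exact MClo.base ⟨(rep_gen k l).isPB, idpt_gen k l⟩

theorem genF_comm {n : ℕ} (k l : Fin n) : genF k l = genF l k := by
  funext x
  rcases x with m | m
  · rw [genF_inl, genF_inl]; split_ifs <;> simp_all
  · rw [genF_inr, genF_inr]; split_ifs <;> simp_all

theorem gen_comm {n : ℕ} (k l : Fin n) : gen k l = gen l k := by
  have := rep_gen k l
  rw [genF_comm] at this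
  exact this.ext (rep_gen l k)

/-- The generators indexed by unordered pairs. -/
def genS {n : ℕ} (e : Sym2 (Fin n)) : Dgm n := Sym2.lift ⟨gen, gen_comm⟩ e

theorem exists_gens (n : ℕ) : ∃ X : Finset (Dgm n), X.card ≤ 1 + Nat.choose (n + 1) 2 ∧
    (↑X : Set (Dgm n)) = Gset n := by
  refine ⟨insert (oneD n) (Finset.univ.image genS), ?_, ?_⟩
  · refine (Finset.card_insert_le _ _).trans ?_
    have := Finset.card_image_le (s := (Finset.univ : Finset (Sym2 (Fin n)))) (f := genS)
    rw [Finset.card_univ, Sym2.card, Fintype.card_fin] at this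
    omega
  · ext α
    simp only [Finset.coe_insert, Finset.coe_image, Finset.coe_univ, Set.image_univ,
      Set.mem_insert_iff, Set.mem_range, Gset]
    refine or_congr Iff.rfl ?_
    constructor
    · rintro ⟨e, rfl⟩
      induction e using Sym2.ind with
      | _ k l => exact ⟨k, l, rfl⟩
    · rintro ⟨k, l, rfl⟩
      exact ⟨s(k, l), rfl⟩

theorem one_noUB {n : ℕ} (a b : Fin n) : ¬ UB (oneD n) a b := by
  rw [(rep_one n).ub]
  simp [swapUD]

theorem gens_lower {n : ℕ} (hn : 2 ≤ n) (X : Finset (Dgm n))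
    (hX : genSet (pmul (n := n)) ↑X = Tset n) : 1 + Nat.choose (n + 1) 2 ≤ X.card := by
  have key : ∀ z, MClo pmul (↑X : Set (Dgm n)) z → (z = oneD n → oneD n ∈ X) ∧
      (z ≠ oneD n → ∃ x ∈ X, x ≠ oneD n ∧ ∀ a b, UB x a b → UB z a b) := by
    intro z hz
    induction hz with
    | @base x h => exact ⟨fun h' => h' ▸ h, fun h' => ⟨x, h, h', fun _ _ h => h⟩⟩
    | @mul x y hx hy ihx ihy =>
      have hxT : x ∈ Tset n := by rw [← hX]; exact hx
      have hyT : y ∈ Tset n := by rw [← hX]; exact hy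
      constructor
      · intro h1
        refine ihx.1 (T_full hn hxT ?_)
        intro a b hab
        have := hab.mul y
        rw [h1] at this
        exact one_noUB a b this
      · intro h1
        by_cases hx1 : x = oneD n
        · obtain ⟨f, hf⟩ := (T_pb hyT).exists_rep
          have hy1 : pmul x y = y := by rw [hx1]; exact (one_mul_rep hf).ext hf
          rw [hy1] at h1 ⊢
          exact ihy.2 h1
        · obtain ⟨w, hw, hw1, hw2⟩ := ihx.2 hx1
          exact ⟨w, hw, hw1, fun a b h => (hw2 a b h).mul y⟩
  have hmem : ∀ z, z ∈ Tset n → MClo pmul (↑X : Set (Dgm n)) z := by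
    intro z hz
    rw [← hX] at hz
    exact hz
  have h1 : oneD n ∈ X :=
    (key _ (hmem _ (idpt_T (rep_one n).isPB (idpt_one n)))).1 rfl
  have h2 : ∀ e : Sym2 (Fin n), ∃ x ∈ X, x ≠ oneD n ∧ ∀ a b, UB x a b → s(a, b) = e := by
    intro e
    induction e using Sym2.ind with
    | _ k l =>
    obtain ⟨x, hx, hx1, hx2⟩ := (key _ (hmem _ (idpt_T (rep_gen k l).isPB (idpt_gen k l)))).2
      (by
        intro h
        have : UB (gen k l) k l := ((rep_gen k l).ub k l).2 (by simp [genF_inl])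
        rw [h] at this
        exact one_noUB _ _ this)
    refine ⟨x, hx, hx1, fun a b hab => ?_⟩
    have := ((rep_gen k l).ub a b).1 (hx2 a b hab)
    rw [genF_inl] at this
    rw [Sym2.eq_iff]
    split_ifs at this with h3 h4
    · exact Or.inl ⟨h3, (Sum.inl.inj this).symm⟩
    · exact Or.inr ⟨h4, (Sum.inl.inj this).symm⟩
  choose F hF1 hF2 hF3 using h2
  have hinj : Function.Injective F := by
    intro e e' hee
    have hT : F e ∈ Tset n := by rw [← hX]; exact MClo.base (hF1 e)
    by_contra hne
    refine hF2 e (T_full hn hT ?_)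
    intro a b hab
    have h3 := hF3 e a b hab
    rw [hee] at hab
    exact hne (h3.symm.trans (hF3 e' a b hab))
  have hsub : insert (oneD n) (Finset.univ.image F) ⊆ X := by
    intro x hx
    rw [Finset.mem_insert, Finset.mem_image] at hx
    rcases hx with rfl | ⟨e, _, rfl⟩
    · exact h1
    · exact hF1 e
  have hc := Finset.card_le_card hsub
  rw [Finset.card_insert_of_notMem, Finset.card_image_of_injective _ hinj, Finset.card_univ,
    Sym2.card, Fintype.card_fin] at hc
  · omega
  · rw [Finset.mem_image]
    rintro ⟨e, _, he⟩
    exact hF2 e he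

end Dgm

/-- For `n ≥ 2`, the idempotent-generated subsemigroup of
`PB_n` is `E(D_n ∪ D_{n-1}) ∪ I_{n-2}`, and its rank and idempotent rank both
equal `1 + C(n+1,2)`. -/
theorem idempotent_generated_PB (n : ℕ) (h : 2 ≤ n) :
    genSet (pmul (n := n)) {α | α ∈ PBset n ∧ IsIdpt α} =
      {α | α ∈ DPB n n ∪ DPB n (n - 1) ∧ IsIdpt α} ∪ IPB n (n - 2) ∧
    rnk (pmul (n := n)) (genSet (pmul (n := n)) {α | α ∈ PBset n ∧ IsIdpt α}) =
      1 + Nat.choose (n + 1) 2 ∧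
    idrnk (pmul (n := n)) (genSet (pmul (n := n)) {α | α ∈ PBset n ∧ IsIdpt α}) =
      1 + Nat.choose (n + 1) 2 := by
  rw [gen_E h]
  obtain ⟨X, hX1, hX2⟩ := exists_gens n
  have hXc : X.card = 1 + Nat.choose (n + 1) 2 :=
    le_antisymm hX1 (gens_lower h X (by rw [hX2]; exact gen_G h))
  have hXi : ∀ x ∈ X, pmul x x = x := by
    intro x hx
    have : x ∈ Gset n := by rw [← hX2]; exact hx
    rcases this with rfl | ⟨k, l, rfl⟩
    · exact idpt_one n
    · exact idpt_gen k l
  have hXg : genSet (pmul (n := n)) ↑X = Tset n := by rw [hX2]; exact gen_G h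
  refine ⟨rfl, le_antisymm ?_ ?_, le_antisymm ?_ ?_⟩
  · exact Nat.sInf_le ⟨X, hXc, hXg⟩
  · obtain ⟨Y, hY, hY2⟩ := Nat.sInf_mem
      (s := {k | ∃ Y : Finset (Dgm n), Y.card = k ∧ genSet (pmul (n := n)) ↑Y = Tset n})
      ⟨_, X, hXc, hXg⟩
    exact (gens_lower h Y hY2).trans hY.le
  · exact Nat.sInf_le ⟨X, hXc, hXi, hXg⟩
  · obtain ⟨Y, hY, _, hY2⟩ := Nat.sInf_mem
      (s := {k | ∃ Y : Finset (Dgm n), Y.card = k ∧ (∀ x ∈ Y, pmul x x = x) ∧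
        genSet (pmul (n := n)) ↑Y = Tset n})
      ⟨_, X, hXc, hXi, hXg⟩
    exact (gens_lower h Y hY2).trans hY.le
end
end
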